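/- arXiv:1006.1226 — 6 statements merged into one kernel-verified Lean document; each statement's English description precedes it below -/
import Mathlib

section
/- For every positive integer n, there exists an involution Φ on the set of improper matrices M_n \ PM_n such that for every improper matrix A in M_n, the matrix Φ(A) is again in M_n \ PM_n, the sum of the entries of the first row of Φ(A) equals the sum of the entries of the first row of A, and the number of rows of Φ(A) differs from the number of rows of A by exactly 1 (so that the parities of n − dim(Φ(A)) and n − dim(A) are opposite). -/
open Polynomial

/-- A finite square matrix of natural numbers, of arbitrary dimension. -/
def SqMat : Type := Σ d : ℕ, Matrix (Fin d) (Fin d) ℕ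

namespace SqMat

/-- The number of rows (= number of columns) of the matrix. -/
def dim (A : SqMat) : ℕ := A.1

/-- The entry in row `r`, column `c` (0-indexed), and `0` out of range. -/
def ent (A : SqMat) (r c : ℕ) : ℕ :=
  if h : r < A.1 ∧ c < A.1 then A.2 ⟨r, h.1⟩ ⟨c, h.2⟩ else 0

/-- The sum of the entries of row `i` (0-indexed). -/
def rsum (A : SqMat) (i : ℕ) : ℕ := ∑ j ∈ Finset.range A.1, A.ent i j

/-- The sum of the entries of column `j` (0-indexed). -/
def csum (A : SqMat) (j : ℕ) : ℕ := ∑ i ∈ Finset.range A.1, A.ent i j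

/-- The sum of all entries of the matrix. -/
def total (A : SqMat) : ℕ := ∑ i ∈ Finset.range A.1, A.rsum i

/-- The least row index (0-indexed) at which column `j` has a nonzero entry. -/
noncomputable def colMin (A : SqMat) (j : ℕ) : ℕ := sInf {i : ℕ | A.ent i j ≠ 0}

/-- The matrix is upper triangular. -/
def UpperTri (A : SqMat) : Prop := ∀ r c : ℕ, c < r → A.ent r c = 0

/-- All entries are `0` or `1`. -/
def ZeroOne (A : SqMat) : Prop := ∀ r c : ℕ, A.ent r c ≤ 1

/-- Every column contains at least one nonzero entry. -/
def ColsNonzero (A : SqMat) : Prop := ∀ j < A.1, 0 < A.csum j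

/-- Every row contains at least one nonzero entry. -/
def RowsNonzero (A : SqMat) : Prop := ∀ i < A.1, 0 < A.rsum i

/-- Membership in `M_n`: upper triangular `(0,1)`-matrices with entries summing
to `n` in which every column contains at least one nonzero entry. -/
def MemM (n : ℕ) (A : SqMat) : Prop :=
  A.UpperTri ∧ A.ZeroOne ∧ A.total = n ∧ A.ColsNonzero

/-- Column `j` (0-indexed; so `j` corresponds to the 1-indexed column `j+1` of the paper)
is improper: either its column sum is at least `2`, or `j ≥ 1`, its column sum is `1`,
its row sum is `0`, and `min_j(A) < min_{j-1}(A)`. -/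
def ImproperCol (A : SqMat) (j : ℕ) : Prop :=
  2 ≤ A.csum j ∨
    (1 ≤ j ∧ A.csum j = 1 ∧ A.rsum j = 0 ∧ A.colMin j < A.colMin (j - 1))

/-- The matrix is proper: no column is improper. -/
def Proper (A : SqMat) : Prop := ∀ j < A.1, ¬ A.ImproperCol j

/-- Membership in `PM_n`: proper matrices of `M_n`. -/
def MemPM (n : ℕ) (A : SqMat) : Prop := MemM n A ∧ A.Proper

/-- Membership in `I_n`: upper triangular matrices with non-negative integer entries
summing to `n` in which every row and every column contains at least one nonzero entry. -/
def MemI (n : ℕ) (A : SqMat) : Prop :=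
  A.UpperTri ∧ A.total = n ∧ A.RowsNonzero ∧ A.ColsNonzero

end SqMat

namespace SqMat

theorem ent_eq_zero_of_dim_le_row (A : SqMat) {r : ℕ} (c : ℕ) (h : A.1 ≤ r) : A.ent r c = 0 :=
  dif_neg (by omega)

theorem ent_eq_zero_of_dim_le_col (A : SqMat) (r : ℕ) {c : ℕ} (h : A.1 ≤ c) : A.ent r c = 0 :=
  dif_neg (by omega)

theorem ext_ent {A B : SqMat} (hd : A.1 = B.1) (h : ∀ r c, A.ent r c = B.ent r c) : A = B := by
  obtain ⟨d, M⟩ := A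
  obtain ⟨e, N⟩ := B
  obtain rfl : d = e := hd
  congr 1
  ext i j
  simpa [ent] using h i j

/-- The `d × d` matrix with entries `f r c`. -/
def ofFun (d : ℕ) (f : ℕ → ℕ → ℕ) : SqMat := ⟨d, fun i j => f i j⟩

theorem ent_ofFun (d : ℕ) (f : ℕ → ℕ → ℕ) (r c : ℕ) :
    (ofFun d f).ent r c = if r < d ∧ c < d then f r c else 0 := rfl

theorem colMin_eq {A : SqMat} {m j : ℕ} (hm : A.ent m j ≠ 0) (h : ∀ x < m, A.ent x j = 0) :
    A.colMin j = m :=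
  IsLeast.csInf_eq ⟨hm, fun x hx => not_lt.1 fun hlt => hx (h x hlt)⟩

theorem ent_eq_zero_of_lt_colMin {A : SqMat} {x j : ℕ} (h : x < A.colMin j) : A.ent x j = 0 :=
  not_not.1 (Nat.notMem_of_lt_sInf h)

theorem ent_colMin_ne_zero {A : SqMat} {j : ℕ} (h : 0 < A.csum j) :
    A.ent (A.colMin j) j ≠ 0 := by
  obtain ⟨i, -, hi⟩ := Finset.exists_ne_zero_of_sum_ne_zero h.ne'
  exact Nat.sInf_mem (s := {i : ℕ | A.ent i j ≠ 0}) ⟨i, hi⟩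

theorem csum_pos_of_ent_ne_zero {A : SqMat} {b j : ℕ} (h : A.ent b j ≠ 0) : 0 < A.csum j := by
  have hb : b < A.1 := not_le.1 fun hb => h (A.ent_eq_zero_of_dim_le_row j hb)
  exact Nat.pos_of_ne_zero fun h0 =>
    h (Finset.sum_eq_zero_iff.1 h0 b (Finset.mem_range.2 hb))

theorem ent_eq_zero_of_rsum_eq_zero {A : SqMat} {i : ℕ} (h : A.rsum i = 0) (c : ℕ) :
    A.ent i c = 0 := by
  by_cases hc : c < A.1
  · exact Finset.sum_eq_zero_iff.1 h c (Finset.mem_range.2 hc)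
  · exact A.ent_eq_zero_of_dim_le_col i (not_lt.1 hc)

theorem csum_eq_add_sum_erase (A : SqMat) {a j : ℕ} (ha : a < A.1) :
    A.csum j = A.ent a j + ∑ x ∈ (Finset.range A.1).erase a, A.ent x j :=
  (Finset.add_sum_erase _ _ (Finset.mem_range.2 ha)).symm

/-- The increasing map on `ℕ` whose range omits exactly `j + 1`. -/
def skip (j k : ℕ) : ℕ := if k ≤ j then k else k + 1

theorem eq_succ_or_exists_skip (j x : ℕ) : x = j + 1 ∨ ∃ r, x = skip j r := by
  by_cases h : x = j + 1
  · exact Or.inl h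
  · refine Or.inr ⟨if x ≤ j then x else x - 1, ?_⟩
    unfold skip
    grind

theorem skip_lt_skip {j x y : ℕ} : skip j x < skip j y ↔ x < y := by
  unfold skip
  grind

theorem sum_range_succ_eq_skip (f : ℕ → ℕ) {j d : ℕ} (h : j < d) :
    ∑ k ∈ Finset.range (d + 1), f k = f (j + 1) + ∑ k ∈ Finset.range d, f (skip j k) := by
  induction d, h using Nat.le_induction with
  | base =>
    rw [Finset.sum_range_succ, add_comm]
    congr 1
    refine Finset.sum_congr rfl fun k hk => ?_
    rw [skip, if_pos (by have := Finset.mem_range.1 hk; omega)]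
  | succ d hd ih =>
    rw [Finset.sum_range_succ, ih, Finset.sum_range_succ _ d, skip, if_neg (by omega), add_assoc]

/-- `B` arises from `A` by moving the topmost one of column `j`, in row `a`, to a new column
inserted right after column `j`, and inserting a zero row right after row `j`. -/
structure IsSplit (A B : SqMat) (j a : ℕ) : Prop where
  dim_eq : B.1 = A.1 + 1
  lt_dim : j < A.1
  le : a ≤ j
  row_zero : ∀ c, B.ent (j + 1) c = 0
  ent_eq : ∀ r c, A.ent r c =
    B.ent (skip j r) (skip j c) + if c = j then B.ent (skip j r) (j + 1) else 0
  new_col : ∀ x, B.ent x (j + 1) = if x = a then 1 else 0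
  above : ∀ x ≤ a, B.ent x j = 0
  exists_ne_zero : ∃ b, B.ent b j ≠ 0

namespace IsSplit

variable {A B : SqMat} {j a : ℕ}

theorem rsum_skip (h : IsSplit A B j a) (r : ℕ) : B.rsum (skip j r) = A.rsum r := by
  have hj := Finset.mem_range.2 h.lt_dim
  simp only [rsum, h.dim_eq, h.ent_eq, sum_range_succ_eq_skip _ h.lt_dim, Finset.sum_add_distrib,
    Finset.sum_ite_eq', if_pos hj]
  ring

theorem rsum_succ (h : IsSplit A B j a) : B.rsum (j + 1) = 0 :=
  Finset.sum_eq_zero fun c _ => h.row_zero c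

theorem csum_eq (h : IsSplit A B j a) (c : ℕ) :
    A.csum c = B.csum (skip j c) + if c = j then B.csum (j + 1) else 0 := by
  simp only [csum, h.dim_eq, h.ent_eq, sum_range_succ_eq_skip _ h.lt_dim, Finset.sum_add_distrib,
    h.row_zero, zero_add]
  split_ifs <;> simp

theorem csum_succ (h : IsSplit A B j a) : B.csum (j + 1) = 1 := by
  have ha : a < B.1 := by have := h.lt_dim; have := h.dim_eq; have := h.le; omega
  simp [csum, h.new_col, ha]

theorem csum_pos (h : IsSplit A B j a) : 0 < B.csum j :=
  h.exists_ne_zero.elim fun _ => csum_pos_of_ent_ne_zero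

theorem skip_self : skip j j = j := if_pos le_rfl

theorem two_le_csum (h : IsSplit A B j a) : 2 ≤ A.csum j := by
  have h1 := h.csum_eq j
  rw [if_pos rfl, skip_self, h.csum_succ] at h1
  have := h.csum_pos
  omega

theorem total_eq (h : IsSplit A B j a) : B.total = A.total := by
  simp only [total, h.dim_eq, sum_range_succ_eq_skip _ h.lt_dim, h.rsum_succ, h.rsum_skip,
    zero_add]

theorem rsum_zero (h : IsSplit A B j a) : B.rsum 0 = A.rsum 0 := by
  simpa [skip] using h.rsum_skip 0

theorem colMin_succ (h : IsSplit A B j a) : B.colMin (j + 1) = a :=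
  colMin_eq (by simp [h.new_col]) fun x hx => by simp [h.new_col, hx.ne]

theorem lt_colMin (h : IsSplit A B j a) : a < B.colMin j :=
  not_le.1 fun hle => ent_colMin_ne_zero h.csum_pos (h.above _ hle)

theorem skip_top (h : IsSplit A B j a) : skip j a = a := if_pos h.le

theorem colMin_eq_top (h : IsSplit A B j a) : A.colMin j = a := by
  refine colMin_eq ?_ fun x hx => ?_
  · simp [h.ent_eq, h.skip_top, h.new_col]
  · have hs : skip j x = x := if_pos (hx.le.trans h.le)
    simp [h.ent_eq, hs, h.new_col, hx.ne, skip_self, h.above x hx.le]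

theorem colMin_add_one (h : IsSplit A B j a) {k : ℕ} (hk : j ≤ k) (hA : 0 < A.csum k) :
    B.colMin (k + 1) = skip j (A.colMin k) := by
  rcases hk.eq_or_lt with rfl | hlt
  · rw [h.colMin_succ, h.colMin_eq_top, h.skip_top]
  have hs : skip j k = k + 1 := if_neg (by omega)
  have he : ∀ r, B.ent (skip j r) (k + 1) = A.ent r k := fun r => by
    rw [h.ent_eq, if_neg hlt.ne', hs, add_zero]
  refine colMin_eq ((he _).trans_ne (ent_colMin_ne_zero hA)) fun x hx => ?_
  rcases eq_succ_or_exists_skip j x with rfl | ⟨r, rfl⟩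
  · exact h.row_zero _
  · rw [he, ent_eq_zero_of_lt_colMin (skip_lt_skip.1 hx)]

theorem memM_of_left (h : IsSplit A B j a) {n : ℕ} (hA : MemM n A) : MemM n B := by
  obtain ⟨hU, hZ, hT, hC⟩ := hA
  refine ⟨fun x y hxy => ?_, fun x y => ?_, h.total_eq.trans hT, fun y hy => ?_⟩
  · rcases eq_succ_or_exists_skip j x with rfl | ⟨r, rfl⟩
    · exact h.row_zero _
    rcases eq_succ_or_exists_skip j y with rfl | ⟨c, rfl⟩
    · have hjr : j < r := by
        unfold skip at hxy
        split_ifs at hxy <;> omega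
      have := (h.ent_eq r j).symm.trans (hU r j hjr)
      rw [if_pos rfl] at this
      omega
    · have := (h.ent_eq r c).symm.trans (hU r c (skip_lt_skip.1 hxy))
      omega
  · rcases eq_succ_or_exists_skip j x with rfl | ⟨r, rfl⟩
    · simp [h.row_zero]
    rcases eq_succ_or_exists_skip j y with rfl | ⟨c, rfl⟩
    · rw [h.new_col]
      split_ifs <;> omega
    · have := (h.ent_eq r c).symm.trans_le (hZ r c)
      omega
  · rcases eq_succ_or_exists_skip j y with rfl | ⟨c, rfl⟩
    · simp [h.csum_succ]
    by_cases hc : c = j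
    · rw [hc, skip_self]
      exact h.csum_pos
    · have hcd : c < A.1 := by
        have := h.dim_eq
        have := h.lt_dim
        unfold skip at hy
        split_ifs at hy <;> omega
      have := h.csum_eq c
      rw [if_neg hc, add_zero] at this
      exact this ▸ hC c hcd

theorem memM_of_right (h : IsSplit A B j a) {n : ℕ} (hB : MemM n B) : MemM n A := by
  obtain ⟨hU, hZ, hT, hC⟩ := hB
  refine ⟨fun r c hrc => ?_, fun r c => ?_, h.total_eq.symm.trans hT, fun c hc => ?_⟩
  · rw [h.ent_eq, hU _ _ (skip_lt_skip.2 hrc), zero_add]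
    split_ifs with hcj
    · refine hU _ _ ?_
      rw [skip, if_neg (by omega)]
      omega
    · rfl
  · rw [h.ent_eq]
    split_ifs with hcj
    · rw [h.new_col]
      split_ifs with hra
      · rw [hcj, skip_self, hra, h.above a le_rfl]
      · exact hZ _ _
    · exact hZ _ _
  · rw [h.csum_eq]
    refine Nat.add_pos_left (hC _ ?_) _
    have := h.dim_eq
    unfold skip
    split_ifs <;> omega

theorem improperCol_add_one_iff (h : IsSplit A B j a) (hA : A.ColsNonzero) {k : ℕ} (hk : j < k)
    (hkd : k < A.1) : B.ImproperCol (k + 1) ↔ A.ImproperCol k := by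
  have hs : skip j k = k + 1 := if_neg (by omega)
  have hc : B.csum (k + 1) = A.csum k := by rw [h.csum_eq, if_neg hk.ne', hs, add_zero]
  have hr : B.rsum (k + 1) = A.rsum k := by rw [← h.rsum_skip, hs]
  have h1 := h.colMin_add_one hk.le (hA k hkd)
  have h2 := h.colMin_add_one (k := k - 1) (by omega) (hA _ (by omega))
  rw [Nat.sub_add_cancel (by omega)] at h2
  rw [ImproperCol, ImproperCol, hc, hr, h1, Nat.add_sub_cancel, h2, skip_lt_skip]
  have : 1 ≤ k := by omega
  simp [this]

theorem improperCol_succ (h : IsSplit A B j a) : B.ImproperCol (j + 1) :=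
  Or.inr ⟨by omega, h.csum_succ, h.rsum_succ, by
    rw [h.colMin_succ, Nat.add_sub_cancel]; exact h.lt_colMin⟩

theorem right_unique {B' : SqMat} {a' : ℕ} (h : IsSplit A B j a) (h' : IsSplit A B' j a') :
    B = B' := by
  obtain rfl : a = a' := h.colMin_eq_top.symm.trans h'.colMin_eq_top
  refine ext_ent (h.dim_eq.trans h'.dim_eq.symm) fun x y => ?_
  rcases eq_succ_or_exists_skip j x with rfl | ⟨r, rfl⟩
  · rw [h.row_zero, h'.row_zero]
  rcases eq_succ_or_exists_skip j y with rfl | ⟨c, rfl⟩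
  · rw [h.new_col, h'.new_col]
  · have := (h.ent_eq r c).symm.trans (h'.ent_eq r c)
    rw [h.new_col, h'.new_col] at this
    omega

theorem left_unique {A' : SqMat} {a' : ℕ} (h : IsSplit A B j a) (h' : IsSplit A' B j a') :
    A = A' :=
  ext_ent (Nat.succ_injective (h.dim_eq.symm.trans h'.dim_eq)) fun r c => by
    rw [h.ent_eq, h'.ent_eq]

end IsSplit

theorem exists_isSplit_left {n : ℕ} {A : SqMat} {j : ℕ} (hA : MemM n A) (hj : j < A.1)
    (h2 : 2 ≤ A.csum j) : ∃ B a, IsSplit A B j a := by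
  obtain ⟨hU, hZ, -, -⟩ := hA
  have ha0 := ent_colMin_ne_zero (show 0 < A.csum j by omega)
  have hmin := fun x => @ent_eq_zero_of_lt_colMin A x j
  generalize A.colMin j = a at *
  have haj : a ≤ j := not_lt.1 fun h => ha0 (hU _ _ h)
  have ha1 : A.ent a j = 1 := by have := hZ a j; omega
  obtain ⟨b, hba, hb⟩ : ∃ b, b ≠ a ∧ A.ent b j ≠ 0 := by
    by_contra! hcon
    rw [A.csum_eq_add_sum_erase (haj.trans_lt hj),
      Finset.sum_eq_zero fun x hx => hcon x (Finset.ne_of_mem_erase hx)] at h2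
    omega
  have hbj : b ≤ j := not_lt.1 fun h => hb (hU _ _ h)
  have hrow := fun r c => A.ent_eq_zero_of_dim_le_row (r := r) c
  have hcol := fun r c => A.ent_eq_zero_of_dim_le_col r (c := c)
  refine ⟨ofFun (A.1 + 1) fun x y =>
    if x = j + 1 then 0
    else if y = j + 1 then if x = a then 1 else 0
    else if y = j ∧ x = a then 0
    else A.ent (if x ≤ j then x else x - 1) (if y ≤ j then y else y - 1), a, rfl, hj, haj,
    fun c => ?_, fun r c => ?_, fun x => ?_, fun x hx => ?_, b, ?_⟩
  all_goals simp only [ent_ofFun, skip]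
  all_goals grind

theorem exists_isSplit_right {n : ℕ} {B : SqMat} {j : ℕ} (hB : MemM n B) (hj : j + 1 < B.1)
    (h1 : B.csum (j + 1) = 1) (hr : B.rsum (j + 1) = 0)
    (hlt : B.colMin (j + 1) < B.colMin j) : ∃ A a, IsSplit A B j a := by
  obtain ⟨hU, hZ, -, hC⟩ := hB
  have ha0 := ent_colMin_ne_zero (show 0 < B.csum (j + 1) by omega)
  have hb := ent_colMin_ne_zero (hC j (by omega))
  have habove := fun x => @ent_eq_zero_of_lt_colMin B x j
  have hrow := ent_eq_zero_of_rsum_eq_zero hr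
  generalize B.colMin (j + 1) = a at *
  generalize B.colMin j = b at *
  have hbj : b ≤ j := not_lt.1 fun h => hb (hU _ _ h)
  have ha1 : B.ent a (j + 1) = 1 := by have := hZ a (j + 1); omega
  have hcol : ∀ x, x ≠ a → B.ent x (j + 1) = 0 := fun x hx => by
    by_cases hxd : x < B.1
    · rw [B.csum_eq_add_sum_erase (a := a) (by omega), ha1, Nat.add_eq_left,
        Finset.sum_eq_zero_iff] at h1
      exact h1 x (Finset.mem_erase.2 ⟨hx, Finset.mem_range.2 hxd⟩)
    · exact B.ent_eq_zero_of_dim_le_row _ (not_lt.1 hxd)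
  have hor := fun r c => B.ent_eq_zero_of_dim_le_row (r := r) c
  have hoc := fun r c => B.ent_eq_zero_of_dim_le_col r (c := c)
  refine ⟨ofFun (B.1 - 1) fun r c =>
    B.ent (skip j r) (skip j c) + if c = j then B.ent (skip j r) (j + 1) else 0, a,
    (Nat.sub_add_cancel (by omega)).symm, show j < B.1 - 1 by omega, by omega, hrow,
    fun r c => ?_, fun x => ?_, fun x hx => habove x (by omega), b, hb⟩
  · simp only [ent_ofFun, skip]
    grind
  · split_ifs with h
    · exact h ▸ ha1
    · exact hcol x h

/-- Column `j` is the last improper column of `A`. -/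
def IsLastImproper (A : SqMat) (j : ℕ) : Prop :=
  j < A.1 ∧ A.ImproperCol j ∧ ∀ k < A.1, j < k → ¬ A.ImproperCol k

theorem IsLastImproper.unique {A : SqMat} {i j : ℕ} (hi : A.IsLastImproper i)
    (hj : A.IsLastImproper j) : i = j := by
  rcases lt_trichotomy i j with h | h | h
  · exact absurd hj.2.1 (hi.2.2 j hj.1 h)
  · exact h
  · exact absurd hi.2.1 (hj.2.2 i hi.1 h)

theorem exists_isLastImproper {A : SqMat} (h : ¬ A.Proper) : ∃ j, A.IsLastImproper j := by
  classical
  simp only [Proper, not_forall, not_not] at h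
  obtain ⟨i, hi, hi'⟩ := h
  obtain ⟨j, hj, hmax⟩ := ((Finset.range A.1).filter A.ImproperCol).exists_max_image id
    ⟨i, Finset.mem_filter.2 ⟨Finset.mem_range.2 hi, hi'⟩⟩
  obtain ⟨hjd, hj'⟩ := Finset.mem_filter.1 hj
  exact ⟨j, Finset.mem_range.1 hjd, hj', fun k hk hjk hki => absurd hjk
    (hmax k (Finset.mem_filter.2 ⟨Finset.mem_range.2 hk, hki⟩)).not_gt⟩

theorem IsLastImproper.not_memPM {A : SqMat} {j n : ℕ} (h : A.IsLastImproper j) :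
    ¬ MemPM n A := fun hP => hP.2 j h.1 h.2.1

theorem IsSplit.isLastImproper_iff {A B : SqMat} {j a : ℕ} (h : IsSplit A B j a)
    (hA : A.ColsNonzero) : B.IsLastImproper (j + 1) ↔ A.IsLastImproper j := by
  have hd := h.dim_eq
  have hj := h.lt_dim
  constructor
  · rintro ⟨-, -, hlast⟩
    exact ⟨hj, Or.inl h.two_le_csum, fun k hk hjk hki => hlast (k + 1) (by omega) (by omega)
      ((h.improperCol_add_one_iff hA hjk hk).2 hki)⟩
  · rintro ⟨-, -, hlast⟩
    refine ⟨by omega, h.improperCol_succ, fun k hk hjk hki => ?_⟩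
    obtain ⟨k, rfl⟩ : ∃ l, k = l + 1 := ⟨k - 1, by omega⟩
    exact hlast k (by omega) (by omega)
      ((h.improperCol_add_one_iff hA (by omega) (by omega)).1 hki)

/-- `B` arises from `A` by splitting the last improper column of `A`, and the column so created
is the last improper column of `B`. -/
def IsLastSplit (A B : SqMat) : Prop :=
  ∃ j a, IsSplit A B j a ∧ A.IsLastImproper j ∧ B.IsLastImproper (j + 1)

/-- One of `A`, `B` arises from the other by splitting the last improper column. -/
def IsPartner (A B : SqMat) : Prop := IsLastSplit A B ∨ IsLastSplit B A

theorem IsPartner.symm {A B : SqMat} (h : IsPartner A B) : IsPartner B A := Or.symm h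

theorem IsLastSplit.not_isLastSplit {A B C : SqMat} (h : IsLastSplit A B) :
    ¬ IsLastSplit C A := by
  rintro ⟨i, b, hs', -, hi⟩
  obtain ⟨j, a, hs, hj, -⟩ := h
  have h2 := hs.two_le_csum
  rw [hj.unique hi, hs'.csum_succ] at h2
  omega

theorem IsPartner.unique {A B C : SqMat} (hB : IsPartner A B) (hC : IsPartner A C) : B = C := by
  rcases hB with hB | hB <;> rcases hC with hC | hC
  · obtain ⟨j, a, hs, hj, -⟩ := hB
    obtain ⟨i, b, hs', hi, -⟩ := hC
    obtain rfl := hj.unique hi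
    exact hs.right_unique hs'
  · exact absurd hC hB.not_isLastSplit
  · exact absurd hB hC.not_isLastSplit
  · obtain ⟨j, a, hs, -, hj⟩ := hB
    obtain ⟨i, b, hs', -, hi⟩ := hC
    obtain rfl := Nat.succ_injective (hj.unique hi)
    exact hs.left_unique hs'

theorem exists_isPartner {n : ℕ} {A : SqMat} (hA : MemM n A) (hP : ¬ A.Proper) :
    ∃ B, IsPartner A B := by
  obtain ⟨j, hj⟩ := exists_isLastImproper hP
  rcases hj.2.1 with h2 | ⟨hj1, h1, hr, hlt⟩
  · obtain ⟨B, a, hs⟩ := exists_isSplit_left hA hj.1 h2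
    exact ⟨B, Or.inl ⟨j, a, hs, hj, (hs.isLastImproper_iff hA.2.2.2).2 hj⟩⟩
  · obtain ⟨j, rfl⟩ : ∃ i, j = i + 1 := ⟨j - 1, by omega⟩
    obtain ⟨B, a, hs⟩ := exists_isSplit_right hA hj.1 h1 hr hlt
    exact ⟨B, Or.inr ⟨j, a, hs, (hs.isLastImproper_iff (hs.memM_of_right hA).2.2.2).1 hj, hj⟩⟩

end SqMat

/-- For every positive integer `n`, there exists an involution `Φ` on the
set of improper matrices `M_n \ PM_n` such that for every matrix `A` in `M_n \ PM_n`,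
`Φ A` is again in `M_n \ PM_n`, the first-row sum is preserved, and the number of rows
changes by exactly `1` (so the parities of `n - dim (Φ A)` and `n - dim A` are opposite). -/
theorem exists_parity_reversing_weight_preserving_involution (n : ℕ) (hn : 0 < n) :
    ∃ Φ : SqMat → SqMat,
      ∀ A : SqMat, (SqMat.MemM n A ∧ ¬ SqMat.MemPM n A) →
        (SqMat.MemM n (Φ A) ∧ ¬ SqMat.MemPM n (Φ A)) ∧
        Φ (Φ A) = A ∧
        (Φ A).rsum 0 = A.rsum 0 ∧
        ((Φ A).dim = A.dim + 1 ∨ (Φ A).dim + 1 = A.dim) := by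
  classical
  refine ⟨fun A => if h : ∃ B, A.IsPartner B then h.choose else A, fun A ⟨hM, hPM⟩ => ?_⟩
  obtain ⟨B, hB⟩ := SqMat.exists_isPartner hM fun hP => hPM ⟨hM, hP⟩
  have hΦ : ∀ {C D : SqMat}, C.IsPartner D →
      (if h : ∃ B, C.IsPartner B then h.choose else C) = D := fun {C D} hCD => by
    have h : ∃ B, C.IsPartner B := ⟨D, hCD⟩
    rw [dif_pos h]
    exact h.choose_spec.unique hCD
  simp only [hΦ hB, hΦ hB.symm, true_and]
  rcases hB with ⟨j, a, hs, -, hj⟩ | ⟨j, a, hs, hj, -⟩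
  · exact ⟨⟨hs.memM_of_left hM, hj.not_memPM⟩, hs.rsum_zero, Or.inl hs.dim_eq⟩
  · exact ⟨⟨hs.memM_of_right hM, hj.not_memPM⟩, hs.rsum_zero.symm, Or.inr hs.dim_eq.symm⟩
end

section
/- For every positive integer n, the following identity of polynomials in z holds: (Σ over matrices A in M_n with n − dim(A) even of z^{rsum_1(A)}) − (Σ over matrices A in M_n with n − dim(A) odd of z^{rsum_1(A)}) = Σ_{d=1}^{n} Σ over compositions n_1 + n_2 + ⋯ + n_d = n with all n_j ≥ 1 of (−1)^{n−d} ∏_{j=1}^{d} ( C(j−1, n_j) + z · C(j−1, n_j − 1) ). -/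
open Polynomial

namespace SqMat

theorem ent_of_dim_le_col (A : SqMat) {r c : ℕ} (h : A.1 ≤ c) : A.ent r c = 0 :=
  dif_neg (by omega)

theorem total_eq_sum_csum (A : SqMat) : A.total = ∑ j ∈ Finset.range A.1, A.csum j :=
  Finset.sum_comm

/-- The set of row indices at which column `j` has a `1`. -/
def colSupport (A : SqMat) (j : ℕ) : Finset ℕ :=
  (Finset.range (j + 1)).filter fun r => A.ent r j = 1

theorem mem_colSupport {A : SqMat} (hU : A.UpperTri) {r j : ℕ} :
    r ∈ A.colSupport j ↔ A.ent r j = 1 := by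
  simp only [colSupport, Finset.mem_filter, Finset.mem_range, and_iff_right_iff_imp]
  intro h
  by_contra hr
  simp [hU r j (by omega)] at h

theorem ent_eq_ite {A : SqMat} (hU : A.UpperTri) (hZ : A.ZeroOne) (r j : ℕ) :
    A.ent r j = if r ∈ A.colSupport j then 1 else 0 := by
  have := hZ r j
  split_ifs with h <;> rw [mem_colSupport hU] at h <;> omega

theorem csum_eq_card {A : SqMat} (hU : A.UpperTri) (hZ : A.ZeroOne) {j : ℕ} (hj : j < A.1) :
    A.csum j = (A.colSupport j).card := by
  simp only [csum, ent_eq_ite hU hZ, Finset.sum_boole, Nat.cast_id]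
  congr 1
  ext r
  simp only [colSupport, Finset.mem_filter, Finset.mem_range]
  constructor
  · exact fun h => h.2
  · exact fun h => ⟨by omega, h⟩

/-- The `(0,1)`-matrix whose column `j` has its ones exactly in the rows of `p j`. -/
def ofColumns {d : ℕ} (p : Fin d → Finset ℕ) : SqMat :=
  ⟨d, fun r j => if (r : ℕ) ∈ p j then 1 else 0⟩

section ofColumns

variable {d : ℕ} {p : Fin d → Finset ℕ}

theorem ent_ofColumns (hp : ∀ j : Fin d, p j ⊆ Finset.range (j + 1)) (r : ℕ) (j : Fin d) :
    (ofColumns p).ent r j = if r ∈ p j then 1 else 0 := by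
  by_cases hr : r < d
  · simp [ent, ofColumns, hr]
  · have : r ∉ p j := fun h => by
      have := Finset.mem_range.1 (hp j h)
      omega
    simp [ent, ofColumns, hr, this]

theorem upperTri_ofColumns (hp : ∀ j : Fin d, p j ⊆ Finset.range (j + 1)) :
    (ofColumns p).UpperTri := by
  intro r c hrc
  by_cases hc : c < d
  · rw [ent_ofColumns hp r ⟨c, hc⟩, if_neg]
    intro h
    have := Finset.mem_range.1 (hp _ h)
    simp only at this
    omega
  · exact ent_of_dim_le_col _ (not_lt.1 hc)

theorem zeroOne_ofColumns : (ofColumns p).ZeroOne := by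
  intro r c
  unfold ent ofColumns
  split_ifs with h
  · change (if r ∈ p ⟨c, h.2⟩ then 1 else 0) ≤ 1
    split_ifs <;> simp
  · simp

theorem colSupport_ofColumns (hp : ∀ j : Fin d, p j ⊆ Finset.range (j + 1)) (j : Fin d) :
    (ofColumns p).colSupport j = p j := by
  ext r
  rw [mem_colSupport (upperTri_ofColumns hp), ent_ofColumns hp]
  simp

theorem csum_ofColumns (hp : ∀ j : Fin d, p j ⊆ Finset.range (j + 1)) (j : Fin d) :
    (ofColumns p).csum j = (p j).card := by
  rw [csum_eq_card (upperTri_ofColumns hp) zeroOne_ofColumns j.2, colSupport_ofColumns hp]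

theorem rsum_ofColumns (hp : ∀ j : Fin d, p j ⊆ Finset.range (j + 1)) (r : ℕ) :
    (ofColumns p).rsum r = ∑ j : Fin d, if r ∈ p j then 1 else 0 := by
  rw [rsum, show (ofColumns p).1 = d from rfl, Finset.sum_range]
  exact Finset.sum_congr rfl fun j _ => ent_ofColumns hp r j

end ofColumns

theorem ofColumns_colSupport {A : SqMat} (hU : A.UpperTri) (hZ : A.ZeroOne) {d : ℕ}
    (hd : d = A.1) : ofColumns (fun j : Fin d => A.colSupport j) = A := by
  subst hd
  refine ext_ent rfl fun r c => ?_
  by_cases hc : c < A.1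
  · exact (ent_ofColumns (fun j => Finset.filter_subset _ _) r ⟨c, hc⟩).trans
      (ent_eq_ite hU hZ r c).symm
  · exact (ent_of_dim_le_col (ofColumns _) (not_lt.1 hc)).trans
      (ent_of_dim_le_col A (not_lt.1 hc)).symm

/-- The column sums of a matrix of `M_n`, as a composition of `n`. -/
def columnComposition {n : ℕ} {A : SqMat} (h : MemM n A) : Composition n where
  blocks := (List.range A.1).map A.csum
  blocks_pos := by
    intro i hi
    obtain ⟨j, hj, rfl⟩ := List.mem_map.1 hi
    exact h.2.2.2 j (List.mem_range.1 hj)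
  blocks_sum := by
    rw [← h.2.2.1, total_eq_sum_csum]
    rfl

/-- The compositions of `n`, together with a choice, for each `j`, of as many of the first
`j + 1` row indices as prescribed by the part `j`. -/
def columnData (n : ℕ) : Finset (Σ c : Composition n, Fin c.length → Finset ℕ) :=
  Finset.univ.sigma fun c =>
    Fintype.piFinset fun j : Fin c.length =>
      Finset.powersetCard (c.blocksFun j) (Finset.range (j + 1))

theorem mem_columnData {n : ℕ} {x : Σ c : Composition n, Fin c.length → Finset ℕ} :
    x ∈ columnData n ↔
      ∀ j, x.2 j ⊆ Finset.range (j + 1) ∧ (x.2 j).card = x.1.blocksFun j := by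
  simp [columnData, Finset.mem_powersetCard]

theorem blocks_eq_map_csum {n : ℕ} {x : Σ c : Composition n, Fin c.length → Finset ℕ}
    (hx : x ∈ columnData n) :
    x.1.blocks = (List.range (ofColumns x.2).1).map (ofColumns x.2).csum := by
  rw [mem_columnData] at hx
  refine List.ext_getElem (by simp [ofColumns]) fun i h₁ h₂ => ?_
  have := csum_ofColumns (fun j => (hx j).1) ⟨i, h₁⟩
  simp only at this
  simp [this, (hx _).2, Composition.blocksFun]

theorem injOn_ofColumns (n : ℕ) :
    Set.InjOn (fun x : Σ c : Composition n, Fin c.length → Finset ℕ => ofColumns x.2)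
      (columnData n) := by
  intro x hx y hy hxy
  have hc : x.1 = y.1 := by
    ext1
    rw [blocks_eq_map_csum hx, blocks_eq_map_csum hy]
    exact congrArg (fun A : SqMat => (List.range A.1).map A.csum) hxy
  obtain ⟨c, p⟩ := x
  obtain ⟨c', q⟩ := y
  obtain rfl : c = c' := hc
  congr 1
  funext j
  exact (colSupport_ofColumns (fun j => (mem_columnData.1 hx j).1) j).symm.trans
    ((congrArg (fun A : SqMat => A.colSupport j) hxy).trans
      (colSupport_ofColumns (fun j => (mem_columnData.1 hy j).1) j))

theorem memM_iff_exists_ofColumns {n : ℕ} {A : SqMat} :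
    MemM n A ↔ ∃ x ∈ columnData n, ofColumns x.2 = A := by
  constructor
  · intro h
    have hlen : (columnComposition h).length = A.1 := by
      simp [columnComposition, Composition.length]
    refine ⟨⟨columnComposition h, fun j => A.colSupport j⟩, mem_columnData.2 fun j =>
      ⟨Finset.filter_subset _ _, ?_⟩, ofColumns_colSupport h.1 h.2.1 hlen⟩
    have hj : (j : ℕ) < A.1 := hlen ▸ j.2
    have hb : (columnComposition h).blocksFun j = A.csum j := by
      change ((List.range A.1).map A.csum)[(j : ℕ)]'(by simpa using hj) = _
      rw [List.getElem_map, List.getElem_range]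
    exact (csum_eq_card h.1 h.2.1 hj).symm.trans hb.symm
  · rintro ⟨x, hx, rfl⟩
    have hp := mem_columnData.1 hx
    refine ⟨upperTri_ofColumns fun j => (hp j).1, zeroOne_ofColumns, ?_, fun j hj => ?_⟩
    · rw [total_eq_sum_csum]
      conv_rhs => rw [← x.1.blocks_sum, blocks_eq_map_csum hx]
      rfl
    · rw [csum_ofColumns (fun j => (hp j).1) ⟨j, hj⟩, (hp _).2]
      exact x.1.blocks_pos' _ _

end SqMat

theorem sum_powersetCard_range_succ_ite {R : Type*} [CommSemiring R] (x : R) (j : ℕ) {k : ℕ}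
    (hk : 0 < k) :
    ∑ s ∈ Finset.powersetCard k (Finset.range (j + 1)), x ^ (if 0 ∈ s then 1 else 0) =
      (j.choose k : R) + x * (j.choose (k - 1) : R) := by
  obtain ⟨k, rfl⟩ := Nat.exists_eq_succ_of_ne_zero hk.ne'
  have h0 : 0 ∉ (Finset.range j).map ⟨Nat.succ, Nat.succ_injective⟩ := by simp
  rw [Finset.range_add_one', Finset.powersetCard_succ_insert h0, Finset.sum_union,
    Finset.sum_image]
  · congr 1
    · rw [Finset.sum_congr rfl (g := fun _ => 1)]
      · simp
      · intro s hs
        rw [if_neg fun h => h0 ((Finset.mem_powersetCard.1 hs).1 h), pow_zero]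
    · simp [mul_comm]
  · intro s hs t ht hst
    have hs' : 0 ∉ s := fun h => h0 ((Finset.mem_powersetCard.1 hs).1 h)
    have ht' : 0 ∉ t := fun h => h0 ((Finset.mem_powersetCard.1 ht).1 h)
    rw [← Finset.erase_insert hs', ← Finset.erase_insert ht', hst]
  · rw [Finset.disjoint_left]
    intro s hs hs'
    obtain ⟨t, -, rfl⟩ := Finset.mem_image.1 hs'
    exact h0 ((Finset.mem_powersetCard.1 hs).1 (Finset.mem_insert_self _ _))

/-- For every positive integer `n`, the weight of the even-parity matrices
of `M_n` minus the weight of the odd-parity ones equals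
`Σ_{d=1}^{n} Σ_{n_1+⋯+n_d=n, n_j ≥ 1} (-1)^{n-d} ∏_{j=1}^{d} (C(j-1,n_j) + z·C(j-1,n_j-1))`.
The inner double sum is expressed as a sum over all `c : Composition n` (whose lengths `d`
range over `1, …, n` since `n ≥ 1`); the paper's 1-indexed `j` corresponds to the 0-indexed
`j : Fin c.length`, with parts `n_j = c.blocksFun j`, and `X` plays the role of `z`. -/
theorem weight_alternating_sum_eq_composition_sum (n : ℕ) (hn : 0 < n) :
    (∑ᶠ A ∈ {A : SqMat | SqMat.MemM n A ∧ Even (n - A.dim)},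
        (X : Polynomial ℤ) ^ A.rsum 0)
      - (∑ᶠ A ∈ {A : SqMat | SqMat.MemM n A ∧ Odd (n - A.dim)},
        (X : Polynomial ℤ) ^ A.rsum 0)
    = ∑ c : Composition n,
        (-1 : Polynomial ℤ) ^ (n - c.length) *
          ∏ j : Fin c.length,
            ((Nat.choose (j : ℕ) (c.blocksFun j) : Polynomial ℤ)
              + X * (Nat.choose (j : ℕ) (c.blocksFun j - 1) : Polynomial ℤ)) := by
  classical
  set F := (SqMat.columnData n).image fun x => SqMat.ofColumns x.2 with hF
  have hmem (A : SqMat) : SqMat.MemM n A ↔ A ∈ F := by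
    rw [SqMat.memM_iff_exists_ofColumns, hF, Finset.mem_image]
  have hset (P : SqMat → Prop) :
      {A : SqMat | SqMat.MemM n A ∧ P A} = (F.filter P : Set SqMat) := by
    ext A
    simp [hmem]
  rw [hset, hset, finsum_mem_coe_finset, finsum_mem_coe_finset, Finset.sum_filter,
    Finset.sum_filter, ← Finset.sum_sub_distrib]
  trans ∑ A ∈ F, (-1) ^ (n - A.dim) * (X : ℤ[X]) ^ A.rsum 0
  · refine Finset.sum_congr rfl fun A _ => ?_
    rcases Nat.even_or_odd (n - A.dim) with h | h
    · simp [h, h.neg_one_pow]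
    · simp [h, h.neg_one_pow, Nat.not_even_iff_odd.2 h]
  rw [hF, Finset.sum_image (SqMat.injOn_ofColumns n),
    SqMat.columnData, Finset.sum_sigma]
  refine Finset.sum_congr rfl fun c _ => ?_
  rw [Finset.prod_congr rfl fun (j : Fin c.length) _ =>
    (sum_powersetCard_range_succ_ite (X : ℤ[X]) (j : ℕ) (c.one_le_blocksFun j)).symm,
    Finset.prod_univ_sum, Finset.mul_sum]
  refine Finset.sum_congr rfl fun p hp => ?_
  rw [SqMat.rsum_ofColumns fun j =>
    (Finset.mem_powersetCard.1 (Fintype.mem_piFinset.1 hp j)).1, Finset.prod_pow_eq_pow_sum]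
  rfl
end

section
/- For every positive integer n, the coefficient of t^n in the polynomial Σ_{m=0}^{n} ∏_{i=1}^{m} ( 1 − (1−t)^{i−1}(1−zt) ), viewed as a polynomial in t with coefficients in ℤ[z], equals Σ_{d=1}^{n} Σ over compositions n_1 + n_2 + ⋯ + n_d = n with all n_j ≥ 1 of (−1)^{n−d} ∏_{j=1}^{d} ( C(j−1, n_j) + z · C(j−1, n_j − 1) ). -/
open Polynomial

namespace Polynomial

variable {R : Type*}

theorem coeff_prod_eq_sum_piAntidiag [CommSemiring R] {ι : Type*} [DecidableEq ι]
    (s : Finset ι) (f : ι → R[X]) (n : ℕ) :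
    (∏ i ∈ s, f i).coeff n = ∑ g ∈ s.piAntidiag n, ∏ i ∈ s, (f i).coeff (g i) := by
  rw [← coeff_coe, ← coeToPowerSeries.ringHom_apply, map_prod, PowerSeries.coeff_prod]
  simp only [coeToPowerSeries.ringHom_apply, coeff_coe]
  refine Finset.sum_nbij (fun l i => l i) ?_ (fun _ _ _ _ h => DFunLike.coe_injective h) ?_
    fun _ _ => rfl
  · intro l hl
    rw [Finset.mem_finsuppAntidiag] at hl
    exact Finset.mem_piAntidiag.2 ⟨hl.1, fun i hi => hl.2 (Finsupp.mem_support_iff.2 hi)⟩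
  · intro g hg
    rw [Finset.mem_coe, Finset.mem_piAntidiag] at hg
    refine ⟨Finsupp.onFinset s g hg.2, ?_, rfl⟩
    rw [Finset.mem_coe, Finset.mem_finsuppAntidiag]
    exact ⟨hg.1, Finsupp.support_onFinset_subset⟩

theorem coeff_sum_prod_range_eq_sum_composition [CommSemiring R] (f : ℕ → R[X])
    (hf : ∀ i, (f i).coeff 0 = 0) (n : ℕ) :
    (∑ m ∈ Finset.range (n + 1), ∏ i ∈ Finset.range m, f i).coeff n =
      ∑ c : Composition n, ∏ j : Fin c.length, (f j).coeff (c.blocksFun j) := by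
  simp_rw [finsetSum_coeff, Finset.prod_range, coeff_prod_eq_sum_piAntidiag]
  rw [Finset.sum_sigma']
  symm
  refine Finset.sum_of_injOn (fun c => ⟨c.length, c.blocksFun⟩) ?_ ?_ ?_ fun _ _ => rfl
  · intro c _ c' _ h
    ext1
    rw [← c.ofFn_blocksFun, ← c'.ofFn_blocksFun]
    exact List.ofFn_inj'.2 h
  · intro c _
    simp
  · rintro ⟨m, g⟩ hg hnot
    rw [Finset.mem_sigma, Finset.mem_piAntidiag] at hg
    by_contra hne
    have hpos : ∀ j, 0 < g j := fun j => Nat.pos_of_ne_zero fun h0 =>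
      hne (Finset.prod_eq_zero (Finset.mem_univ j) (by simp [h0, hf]))
    refine hnot ⟨⟨List.ofFn g, ?_, ?_⟩, by simp, ?_⟩
    · intro i hi
      obtain ⟨j, rfl⟩ := (List.mem_ofFn' _ _).1 hi
      exact hpos j
    · rw [List.sum_ofFn]
      exact hg.2.1
    · exact List.ofFn_inj'.1 (Composition.ofFn_blocksFun _)

theorem coeff_one_sub_X_pow [CommRing R] (i k : ℕ) :
    ((1 - X : R[X]) ^ i).coeff k = (-1) ^ k * (i.choose k : R) := by
  have h : (1 - X : R[X]) ^ i = ((1 + X) ^ i).comp (C (-1) * X) := by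
    simp [sub_eq_add_neg]
  rw [h, comp_C_mul_X_coeff, coeff_one_add_X_pow, mul_comm]

theorem coeff_one_sub_one_sub_X_pow_mul [CommRing R] (z : R) (i : ℕ) {k : ℕ} (hk : 0 < k) :
    (1 - (1 - X) ^ i * (1 - C z * X) : R[X]).coeff k =
      (-1) ^ (k - 1) * ((i.choose k : R) + z * (i.choose (k - 1) : R)) := by
  obtain ⟨k, rfl⟩ := Nat.exists_eq_add_of_lt hk
  have h : (1 - (1 - X) ^ i * (1 - C z * X) : R[X]) =
      1 - (1 - X) ^ i + C z * ((1 - X) ^ i * X) := by ring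
  rw [h, Nat.zero_add]
  simp only [coeff_add, coeff_sub, coeff_C_mul, coeff_mul_X, coeff_one_sub_X_pow, coeff_one,
    Nat.add_sub_cancel, if_neg k.succ_ne_zero]
  ring

end Polynomial

theorem Composition.sum_blocksFun_sub_one {n : ℕ} (c : Composition n) :
    ∑ j, (c.blocksFun j - 1) = n - c.length := by
  rw [Finset.sum_tsub_distrib _ fun j _ => c.one_le_blocksFun j, c.sum_blocksFun]
  simp

/-- For every positive integer `n`, the coefficient of `t^n` in the
polynomial `Σ_{m=0}^{n} ∏_{i=1}^{m} (1 - (1-t)^{i-1}(1-zt))`, viewed as a polynomial in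
`t` over `ℤ[z]`, equals
`Σ_{d=1}^{n} Σ_{n_1+⋯+n_d=n, n_j ≥ 1} (-1)^{n-d} ∏_{j=1}^{d} (C(j-1,n_j) + z·C(j-1,n_j-1))`.
Here the outer polynomial variable `X : Polynomial (Polynomial ℤ)` plays the role of `t`
and `C X` (the constant inner variable) plays the role of `z`; the product index
`i ∈ Finset.range m` corresponds to the paper's `i+1`, so `(1-t)^{i-1}` becomes
`(1 - X)^i`.  The double sum on the right runs over all `c : Composition n`, whose lengths
`d` range over `1, …, n`, with `n_j = c.blocksFun j` for the 0-indexed `j : Fin c.length`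
(so the paper's `C(j-1, n_j)` becomes `C(j, c.blocksFun j)`). -/
theorem coeff_pochhammer_sum_eq_composition_sum (n : ℕ) (hn : 0 < n) :
    (∑ m ∈ Finset.range (n + 1), ∏ i ∈ Finset.range m,
        ((1 : Polynomial (Polynomial ℤ))
          - (1 - X) ^ i * (1 - C X * X))).coeff n
    = ∑ c : Composition n,
        (-1 : Polynomial ℤ) ^ (n - c.length) *
          ∏ j : Fin c.length,
            ((Nat.choose (j : ℕ) (c.blocksFun j) : Polynomial ℤ)
              + X * (Nat.choose (j : ℕ) (c.blocksFun j - 1) : Polynomial ℤ)) := by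
  rw [coeff_sum_prod_range_eq_sum_composition
    (fun i => (1 : Polynomial (Polynomial ℤ)) - (1 - X) ^ i * (1 - C X * X))
    (fun i => by simp [coeff_one_sub_X_pow, mul_coeff_zero])]
  refine Finset.sum_congr rfl fun c _ => ?_
  rw [← c.sum_blocksFun_sub_one, ← Finset.prod_pow_eq_pow_sum, ← Finset.prod_mul_distrib]
  exact Finset.prod_congr rfl fun j _ =>
    coeff_one_sub_one_sub_X_pow_mul X (j : ℕ) (c.one_le_blocksFun j)
end

section
/- For all positive integers n and all k ≥ 0, the number of matrices in PM_n whose first row has entry sum k equals the number of matrices in I_n whose first row has entry sum k; that is, there is a bijection between PM_{n,k} and I_{n,k}. -/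
open Polynomial

namespace SqMat

theorem lt_of_ent_ne_zero {A : SqMat} {r c : ℕ} (h : A.ent r c ≠ 0) : r < A.1 ∧ c < A.1 := by
  by_contra hc
  exact h (dif_neg hc)

/-- The matrix whose column `j` has its only nonzero entry, a `1`, in row `a j`. -/
def ofSeq {n : ℕ} (a : Fin n → Fin n) : SqMat := ⟨n, fun i j => if a j = i then 1 else 0⟩

/-- The sequences `a` for which `ofSeq a` is proper and upper triangular. -/
def IsProperSeq {n : ℕ} (a : Fin n → Fin n) : Prop :=
  (∀ j, a j ≤ j) ∧ ∀ i j : Fin n, i.val + 1 = j.val → a j < a i → ∃ l, a l = j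

section ofSeq

variable {n : ℕ} (a : Fin n → Fin n)

theorem ent_ofSeq (i : ℕ) (j : Fin n) : (ofSeq a).ent i j = if (a j).val = i then 1 else 0 := by
  unfold ent ofSeq
  by_cases h : i < n
  · simp [h, Fin.ext_iff]
  · have : (a j).val ≠ i := by have := (a j).2; omega
    simp [h, this]

theorem csum_ofSeq (j : Fin n) : (ofSeq a).csum j = 1 := by
  have : (ofSeq a).csum j = ∑ i ∈ Finset.range n, if (a j).val = i then 1 else 0 :=
    Finset.sum_congr rfl fun i _ => ent_ofSeq a i j
  rw [this, Finset.sum_ite_eq]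
  simp

theorem rsum_ofSeq (i : ℕ) :
    (ofSeq a).rsum i = (Finset.univ.filter fun j => (a j).val = i).card := by
  have : (ofSeq a).rsum i = ∑ j ∈ Finset.range n, (ofSeq a).ent i j := rfl
  rw [this, Finset.sum_range, Finset.card_filter]
  exact Finset.sum_congr rfl fun j _ => ent_ofSeq a i j

theorem colMin_ofSeq (j : Fin n) : (ofSeq a).colMin j = a j := by
  have : {i : ℕ | (ofSeq a).ent i j ≠ 0} = {(a j).val} := by
    ext i
    rw [Set.mem_ofPred_eq, ent_ofSeq]
    simp [eq_comm]
  rw [colMin, this, csInf_singleton]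

theorem memPM_ofSeq_iff : MemPM n (ofSeq a) ↔ IsProperSeq a := by
  constructor
  · rintro ⟨⟨hU, -⟩, hP⟩
    refine ⟨fun j => ?_, fun i j hij hlt => ?_⟩
    · by_contra h
      have := hU (a j) j (by simpa using h)
      rw [ent_ofSeq] at this
      simp at this
    · by_contra hc
      push Not at hc
      refine hP j j.2 (Or.inr ⟨by omega, csum_ofSeq a j, ?_, ?_⟩)
      · rw [rsum_ofSeq, Finset.card_eq_zero, Finset.filter_eq_empty_iff]
        intro l _ hl
        exact hc l (Fin.ext hl)
      · have e : j.val - 1 = i.val := by omega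
        rw [e, colMin_ofSeq, colMin_ofSeq]
        exact hlt
  · rintro ⟨hle, hp⟩
    refine ⟨⟨fun r c hrc => ?_, fun r c => ?_, ?_, fun j hj => ?_⟩, fun j hj => ?_⟩
    · by_contra h
      have hc : c < n := (lt_of_ent_ne_zero h).2
      have := ent_ofSeq a r ⟨c, hc⟩
      have h2 : (a ⟨c, hc⟩).val ≤ c := hle ⟨c, hc⟩
      rw [if_neg (by omega)] at this
      exact h this
    · by_cases hc : c < n
      · have := ent_ofSeq a r ⟨c, hc⟩
        simp only at this
        rw [this]
        split_ifs <;> simp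
      · by_contra h
        exact hc (lt_of_ent_ne_zero (A := ofSeq a) (r := r) (c := c) (by omega)).2
    · rw [total_eq_sum_csum]
      have : ∑ j ∈ Finset.range n, (ofSeq a).csum j = n := by
        rw [Finset.sum_range, Finset.sum_congr rfl fun j _ => csum_ofSeq a j]
        simp
      exact this
    · have := csum_ofSeq a ⟨j, hj⟩
      simp only at this
      omega
    · have hj' : j < n := hj
      have h1 := csum_ofSeq a ⟨j, hj'⟩
      simp only at h1
      rintro (h | ⟨h0, -, hr, hm⟩)
      · omega
      · have m1 := colMin_ofSeq a ⟨j, hj'⟩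
        have m2 := colMin_ofSeq a ⟨j - 1, by omega⟩
        simp only at m1 m2
        rw [m1, m2] at hm
        obtain ⟨l, hl⟩ := hp ⟨j - 1, by omega⟩ ⟨j, hj'⟩ (by simp only; omega) hm
        rw [rsum_ofSeq, Finset.card_eq_zero, Finset.filter_eq_empty_iff] at hr
        exact hr (Finset.mem_univ l) (by rw [hl])

theorem ofSeq_injective : Function.Injective (ofSeq (n := n)) := by
  intro a b h
  funext j
  have := ent_ofSeq b (a j) j
  rw [← h, ent_ofSeq] at this
  by_contra hne
  rw [if_pos rfl, if_neg (fun e => hne (Fin.ext e.symm))] at this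
  omega

theorem MemPM.exists_ofSeq {A : SqMat} (hA : MemPM n A) : ∃ a : Fin n → Fin n, A = ofSeq a := by
  obtain ⟨⟨-, hZ, hT, hC⟩, hP⟩ := hA
  have hcs : ∀ j < A.1, A.csum j = 1 := fun j hj => by
    have h1 := hC j hj
    have h2 : ¬ 2 ≤ A.csum j := fun h => hP j hj (Or.inl h)
    omega
  have hn : A.1 = n := by
    rw [← hT, total_eq_sum_csum,
      Finset.sum_congr rfl fun j hj => hcs j (Finset.mem_range.1 hj)]
    simp
  have hcol : ∀ j : Fin n, ∃ i : Fin n, ∀ r, A.ent r j = if i.val = r then 1 else 0 := by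
    intro j
    have h1 := hcs j (by omega)
    obtain ⟨i, hi, hne⟩ := Finset.exists_ne_zero_of_sum_ne_zero
      (show ∑ i ∈ Finset.range A.1, A.ent i j ≠ 0 by unfold csum at h1; omega)
    rw [Finset.mem_range] at hi
    refine ⟨⟨i, by omega⟩, fun r => ?_⟩
    by_cases hr : i = r
    · subst hr
      have := hZ i j
      simp only [if_true]
      omega
    · simp only [hr, if_false]
      by_contra h
      have hsub : ({i, r} : Finset ℕ) ⊆ Finset.range A.1 := by
        intro x hx
        simp only [Finset.mem_insert, Finset.mem_singleton] at hx
        have := (lt_of_ent_ne_zero h).1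
        rw [Finset.mem_range]
        omega
      have := Finset.sum_le_sum_of_subset (f := fun i => A.ent i j) hsub
      rw [Finset.sum_pair hr] at this
      unfold csum at h1
      omega
  choose a ha using hcol
  refine ⟨a, ext_ent hn fun r c => ?_⟩
  by_cases hc : c < n
  · exact (ha ⟨c, hc⟩ r).trans (ent_ofSeq a r ⟨c, hc⟩).symm
  · have h1 : A.ent r c = 0 := by
      by_contra h
      exact hc (hn ▸ (lt_of_ent_ne_zero h).2)
    have h2 : (ofSeq a).ent r c = 0 := by
      by_contra h
      exact hc (lt_of_ent_ne_zero h).2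
    rw [h1, h2]

end ofSeq

/-- A monotone listing, column by column, of the units of a `d × d` matrix of `I_n`: the pair
`(y, x)` stands for a unit in row `x` and column `y`. -/
structure IsListing {n : ℕ} (d : ℕ) (p : Fin n → ℕ ×ₗ ℕ) : Prop where
  mono : Monotone p
  row_le_col : ∀ j, (ofLex (p j)).2 ≤ (ofLex (p j)).1
  row_surj : ∀ x, x < d ↔ ∃ j, (ofLex (p j)).2 = x
  col_surj : ∀ y, y < d ↔ ∃ j, (ofLex (p j)).1 = y

/-- The `d × d` matrix whose entry in row `x`, column `y` is the multiplicity of `(y, x)`. -/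
def ofListing {n : ℕ} (d : ℕ) (p : Fin n → ℕ ×ₗ ℕ) : SqMat :=
  ⟨d, fun x y => (Finset.univ.filter fun j => p j = toLex (y.val, x.val)).card⟩

namespace IsListing

variable {n d : ℕ} {p : Fin n → ℕ ×ₗ ℕ}

theorem ent_ofListing (hp : IsListing d p) (x y : ℕ) :
    (ofListing d p).ent x y = (Finset.univ.filter fun j => p j = toLex (y, x)).card := by
  unfold ent ofListing
  by_cases h : x < d ∧ y < d
  · simp only [h, and_self, dif_pos]
  · rw [dif_neg h, eq_comm, Finset.card_eq_zero, Finset.filter_eq_empty_iff]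
    intro j _ hj
    refine h ⟨(hp.row_surj x).2 ⟨j, ?_⟩, (hp.col_surj y).2 ⟨j, ?_⟩⟩ <;> simp [hj]

theorem rsum_ofListing (hp : IsListing d p) (x : ℕ) :
    (ofListing d p).rsum x = (Finset.univ.filter fun j => (ofLex (p j)).2 = x).card := by
  have h : (ofListing d p).rsum x = ∑ y ∈ Finset.range d,
      (Finset.univ.filter fun j => p j = toLex (y, x)).card :=
    Finset.sum_congr rfl fun y _ => hp.ent_ofListing x y
  rw [h, Finset.card_eq_sum_card_fiberwise (f := fun j => (ofLex (p j)).1) (t := Finset.range d)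
    fun j _ => by simpa using (hp.col_surj _).2 ⟨j, rfl⟩]
  refine Finset.sum_congr rfl fun y _ => ?_
  rw [Finset.filter_filter]
  congr 1
  ext j
  simp [← ofLex_inj, Prod.ext_iff, and_comm]

theorem csum_ofListing (hp : IsListing d p) (y : ℕ) :
    (ofListing d p).csum y = (Finset.univ.filter fun j => (ofLex (p j)).1 = y).card := by
  have h : (ofListing d p).csum y = ∑ x ∈ Finset.range d,
      (Finset.univ.filter fun j => p j = toLex (y, x)).card :=
    Finset.sum_congr rfl fun x _ => hp.ent_ofListing x y
  rw [h, Finset.card_eq_sum_card_fiberwise (f := fun j => (ofLex (p j)).2) (t := Finset.range d)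
    fun j _ => by simpa using (hp.row_surj _).2 ⟨j, rfl⟩]
  refine Finset.sum_congr rfl fun y _ => ?_
  rw [Finset.filter_filter]
  congr 1
  ext j
  simp [← ofLex_inj, Prod.ext_iff]

theorem memI_ofListing (hp : IsListing d p) : MemI n (ofListing d p) := by
  refine ⟨fun r c hrc => ?_, ?_, fun x hx => ?_, fun y hy => ?_⟩
  · rw [hp.ent_ofListing, Finset.card_eq_zero, Finset.filter_eq_empty_iff]
    intro j _ hj
    have := hp.row_le_col j
    rw [hj] at this
    simp only [ofLex_toLex] at this
    omega
  · have h : (ofListing d p).total = ∑ x ∈ Finset.range d,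
        (Finset.univ.filter fun j => (ofLex (p j)).2 = x).card :=
      Finset.sum_congr rfl fun x _ => hp.rsum_ofListing x
    rw [h, ← Finset.card_eq_sum_card_fiberwise fun j _ => by
      simpa using (hp.row_surj _).2 ⟨j, rfl⟩]
    simp
  · obtain ⟨j, hj⟩ := (hp.row_surj x).1 hx
    rw [hp.rsum_ofListing]
    exact Finset.card_pos.2 ⟨j, by simpa using hj⟩
  · obtain ⟨j, hj⟩ := (hp.col_surj y).1 hy
    rw [hp.csum_ofListing]
    exact Finset.card_pos.2 ⟨j, by simpa using hj⟩

theorem eq_of_ofListing_eq {d' : ℕ} {p' : Fin n → ℕ ×ₗ ℕ} (hp : IsListing d p)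
    (hp' : IsListing d' p') (h : ofListing d p = ofListing d' p') : d = d' ∧ p = p' := by
  refine ⟨congrArg Sigma.fst h, ?_⟩
  have hperm : (List.ofFn p).Perm (List.ofFn p') := by
    rw [← Multiset.coe_eq_coe, ← Fin.univ_val_map, ← Fin.univ_val_map]
    ext q
    have e := hp.ent_ofListing (ofLex q).2 (ofLex q).1
    rw [h, hp'.ent_ofListing] at e
    rw [Multiset.count_map, Multiset.count_map]
    simpa [Finset.card, eq_comm] using e.symm
  refine List.ofFn_injective (hperm.eq_of_pairwise (le := (· ≤ ·))
    (fun _ _ _ _ => le_antisymm) ?_ ?_)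
  · exact List.pairwise_ofFn.2 fun i j hij => hp.mono hij.le
  · exact List.pairwise_ofFn.2 fun i j hij => hp'.mono hij.le

end IsListing

theorem MemI.exists_ofListing {n : ℕ} {B : SqMat} (hB : MemI n B) :
    ∃ p : Fin n → ℕ ×ₗ ℕ, IsListing B.1 p ∧ B = ofListing B.1 p := by
  obtain ⟨hU, hT, hR, hC⟩ := hB
  let M : Multiset (ℕ ×ₗ ℕ) := ∑ x ∈ Finset.range B.1, ∑ y ∈ Finset.range B.1,
    Multiset.replicate (B.ent x y) (toLex (y, x))
  have hcard : (M.sort (· ≤ ·)).length = n := by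
    rw [Multiset.length_sort, ← hT]
    simp [M, total, rsum]
  have hcount : ∀ x y, M.count (toLex (y, x)) = B.ent x y := by
    intro x y
    simp only [M, Multiset.count_sum', Multiset.count_replicate, toLex_inj, Prod.mk.injEq]
    by_cases h : B.ent x y = 0
    · rw [h]
      refine Finset.sum_eq_zero fun u _ => Finset.sum_eq_zero fun v _ => ?_
      split_ifs with huv
      · rw [huv.1, huv.2, h]
      · rfl
    · obtain ⟨hx, hy⟩ := lt_of_ent_ne_zero h
      rw [Finset.sum_eq_single x, Finset.sum_eq_single y]
      · simp
      · intro v _ hv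
        simp [hv]
      · simp [hy]
      · intro u _ hu
        simp [hu]
      · simp [hx]
  let p : Fin n → ℕ ×ₗ ℕ := fun j => (M.sort (· ≤ ·)).get (j.cast hcard.symm)
  have hpM : Finset.univ.val.map p = M := by
    rw [Fin.univ_val_map]
    conv_rhs => rw [← Multiset.sort_eq M (· ≤ ·)]
    congr 1
    apply List.ext_get
    · simp [hcard]
    · intro i h1 h2
      simp [p]
  have hent : ∀ x y, B.ent x y = (Finset.univ.filter fun j => p j = toLex (y, x)).card := by
    intro x y
    rw [← hcount, ← hpM, Multiset.count_map]
    simp [Finset.card, eq_comm]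
  have hne : ∀ j, B.ent (ofLex (p j)).2 (ofLex (p j)).1 ≠ 0 := by
    intro j
    rw [hent]
    exact (Finset.card_pos.2 ⟨j, by simp⟩).ne'
  have hex : ∀ x y, B.ent x y ≠ 0 → ∃ j, p j = toLex (y, x) := by
    intro x y h
    rw [hent] at h
    obtain ⟨j, hj⟩ := Finset.card_pos.1 (Nat.pos_of_ne_zero h)
    exact ⟨j, (Finset.mem_filter.1 hj).2⟩
  have hp : IsListing B.1 p := by
    refine ⟨fun i j hij => ?_, fun j => ?_, fun x => ⟨fun hx => ?_, ?_⟩,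
      fun y => ⟨fun hy => ?_, ?_⟩⟩
    · have hs : (M.sort (· ≤ ·)).Pairwise (· ≤ ·) := Multiset.pairwise_sort M (· ≤ ·)
      rcases hij.eq_or_lt with rfl | hlt
      · exact le_rfl
      · exact List.pairwise_iff_get.1 hs _ _ hlt
    · by_contra h
      exact hne j (hU _ _ (by omega))
    · obtain ⟨y, -, h⟩ := Finset.exists_ne_zero_of_sum_ne_zero (hR x hx).ne'
      obtain ⟨j, hj⟩ := hex x y h
      exact ⟨j, by simp [hj]⟩
    · rintro ⟨j, rfl⟩
      exact (lt_of_ent_ne_zero (hne j)).1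
    · obtain ⟨x, -, h⟩ := Finset.exists_ne_zero_of_sum_ne_zero (hC y hy).ne'
      obtain ⟨j, hj⟩ := hex x y h
      exact ⟨j, by simp [hj]⟩
    · rintro ⟨j, rfl⟩
      exact (lt_of_ent_ne_zero (hne j)).2
  exact ⟨p, hp, ext_ent rfl fun x y => (hent x y).trans (hp.ent_ofListing x y).symm⟩

/-- The number of listed units lying in the first `x` columns. -/
def unitsBefore {n : ℕ} (p : Fin n → ℕ ×ₗ ℕ) (x : ℕ) : ℕ :=
  (Finset.univ.filter fun j => (ofLex (p j)).1 < x).card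

namespace IsListing

variable {n d : ℕ} {p : Fin n → ℕ ×ₗ ℕ}

theorem col_mono (hp : IsListing d p) {i j : Fin n} (h : i ≤ j) :
    (ofLex (p i)).1 ≤ (ofLex (p j)).1 := by
  rcases Prod.Lex.le_iff.1 (hp.mono h) with h | h
  · exact h.le
  · exact h.1.le

theorem lt_unitsBefore_iff (hp : IsListing d p) (x : ℕ) (j : Fin n) :
    j.val < unitsBefore p x ↔ (ofLex (p j)).1 < x := by
  constructor
  · intro h
    by_contra hx
    refine absurd (Finset.card_le_card (t := Finset.Iio j)
      (s := Finset.univ.filter fun j => (ofLex (p j)).1 < x) fun i hi => ?_)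
      (by rw [Fin.card_Iio]; exact not_le.2 h)
    rw [Finset.mem_Iio]
    by_contra hij
    have := hp.col_mono (not_lt.1 hij)
    have := (Finset.mem_filter.1 hi).2
    omega
  · intro h
    have := Finset.card_le_card (s := Finset.Iic j)
      (t := Finset.univ.filter fun j => (ofLex (p j)).1 < x) fun i hi => by
        have := hp.col_mono (Finset.mem_Iic.1 hi)
        simp only [Finset.mem_filter, Finset.mem_univ, true_and]
        omega
    rw [Fin.card_Iic] at this
    exact this

theorem unitsBefore_lt (hp : IsListing d p) {x y : ℕ} (hx : x < d) (hxy : x < y) :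
    unitsBefore p x < unitsBefore p y := by
  obtain ⟨j, hj⟩ := (hp.col_surj x).1 hx
  have h1 := hp.lt_unitsBefore_iff x j
  have h2 := hp.lt_unitsBefore_iff y j
  omega

theorem unitsBefore_row_le (hp : IsListing d p) (j : Fin n) :
    unitsBefore p (ofLex (p j)).2 ≤ j := by
  have h1 := hp.lt_unitsBefore_iff (ofLex (p j)).2 j
  have h2 := hp.row_le_col j
  omega

/-- The proper sequence encoded by a listing. -/
def toSeq (hp : IsListing d p) (j : Fin n) : Fin n :=
  ⟨unitsBefore p (ofLex (p j)).2, (hp.unitsBefore_row_le j).trans_lt j.2⟩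

theorem isProperSeq_toSeq (hp : IsListing d p) : IsProperSeq hp.toSeq := by
  refine ⟨hp.unitsBefore_row_le, fun i j hij hlt => ?_⟩
  have hlt' : unitsBefore p (ofLex (p j)).2 < unitsBefore p (ofLex (p i)).2 := hlt
  have hs : (ofLex (p j)).2 < (ofLex (p i)).2 := by
    by_contra h
    rcases (not_lt.1 h).eq_or_lt with h | h
    · rw [h] at hlt'
      exact lt_irrefl _ hlt'
    · exact lt_asymm hlt' (hp.unitsBefore_lt ((hp.row_surj _).2 ⟨i, rfl⟩) h)
  have ht : (ofLex (p i)).1 < (ofLex (p j)).1 := by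
    rcases Prod.Lex.le_iff.1 (hp.mono (show i ≤ j by
      rw [Fin.le_def]; omega)) with h | h
    · exact h
    · exact absurd h.2 (not_le.2 hs)
  obtain ⟨l, hl⟩ := (hp.row_surj _).1 ((hp.col_surj (ofLex (p j)).1).2 ⟨j, rfl⟩)
  refine ⟨l, Fin.ext ?_⟩
  change unitsBefore p (ofLex (p l)).2 = j
  rw [hl]
  have h1 := hp.lt_unitsBefore_iff (ofLex (p j)).1 i
  have h2 := hp.lt_unitsBefore_iff (ofLex (p j)).1 j
  omega

theorem toSeq_eq_zero_iff (hp : IsListing d p) (j : Fin n) :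
    (hp.toSeq j).val = 0 ↔ (ofLex (p j)).2 = 0 := by
  change unitsBefore p (ofLex (p j)).2 = 0 ↔ _
  constructor
  · intro h
    by_contra h0
    have := hp.unitsBefore_lt (x := 0)
      ((Nat.zero_le _).trans_lt ((hp.row_surj _).2 ⟨j, rfl⟩)) (Nat.pos_of_ne_zero h0)
    omega
  · intro h
    simp [h, unitsBefore]

theorem unitsBefore_injOn (hp : IsListing d p) :
    Set.InjOn (unitsBefore p) (Set.Iio d) := by
  intro x hx y hy h
  rcases lt_trichotomy x y with hxy | hxy | hxy
  · exact absurd h (hp.unitsBefore_lt hx hxy).ne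
  · exact hxy
  · exact absurd h (hp.unitsBefore_lt hy hxy).ne'

theorem image_toSeq (hp : IsListing d p) :
    Finset.univ.image (fun j => (hp.toSeq j).val) = (Finset.range d).image (unitsBefore p) := by
  ext v
  simp only [Finset.mem_image, Finset.mem_univ, true_and, Finset.mem_range]
  constructor
  · rintro ⟨j, rfl⟩
    exact ⟨_, (hp.row_surj _).2 ⟨j, rfl⟩, rfl⟩
  · rintro ⟨x, hx, rfl⟩
    obtain ⟨j, rfl⟩ := (hp.row_surj x).1 hx
    exact ⟨j, rfl⟩

theorem card_filter_image_toSeq (hp : IsListing d p) (P : ℕ → Prop) [DecidablePred P] {m : ℕ}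
    (hm : m ≤ d) (h : ∀ x < d, P (unitsBefore p x) ↔ x < m) :
    ((Finset.univ.image fun j => (hp.toSeq j).val).filter P).card = m := by
  have : (Finset.univ.image fun j => (hp.toSeq j).val).filter P
      = (Finset.range m).image (unitsBefore p) := by
    rw [hp.image_toSeq]
    ext v
    simp only [Finset.mem_filter, Finset.mem_image, Finset.mem_range]
    constructor
    · rintro ⟨⟨x, hx, rfl⟩, hP⟩
      exact ⟨x, (h x hx).1 hP, rfl⟩
    · rintro ⟨x, hx, rfl⟩
      exact ⟨⟨x, hx.trans_le hm, rfl⟩, (h x (hx.trans_le hm)).2 hx⟩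
  rw [this, Finset.card_image_of_injOn, Finset.card_range]
  refine hp.unitsBefore_injOn.mono fun x hx => ?_
  exact (Finset.mem_range.1 (Finset.mem_coe.1 hx)).trans_le hm

theorem card_image_toSeq (hp : IsListing d p) :
    ((Finset.univ.image fun j => (hp.toSeq j).val).filter fun _ => True).card = d :=
  hp.card_filter_image_toSeq _ le_rfl fun x hx => by simpa using hx

theorem card_image_toSeq_lt (hp : IsListing d p) (j : Fin n) :
    ((Finset.univ.image fun j => (hp.toSeq j).val).filter fun v => v < (hp.toSeq j).val).card
      = (ofLex (p j)).2 := by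
  have hj := (hp.row_surj _).2 ⟨j, rfl⟩
  refine hp.card_filter_image_toSeq _ hj.le fun x hx => ⟨fun h => ?_, hp.unitsBefore_lt hx⟩
  have h' : unitsBefore p x < unitsBefore p (ofLex (p j)).2 := h
  by_contra hc
  rcases (not_lt.1 hc).eq_or_lt with e | e
  · rw [e] at h'
    exact lt_irrefl _ h'
  · exact lt_asymm h' (hp.unitsBefore_lt hj e)

theorem card_image_toSeq_le (hp : IsListing d p) (j : Fin n) :
    ((Finset.univ.image fun j => (hp.toSeq j).val).filter fun v => v ≤ j.val).card
      = (ofLex (p j)).1 + 1 := by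
  have hj := (hp.col_surj _).2 ⟨j, rfl⟩
  refine hp.card_filter_image_toSeq _ hj fun x hx => ?_
  have := hp.lt_unitsBefore_iff x j
  omega

theorem eq_of_toSeq_eq {d' : ℕ} {p' : Fin n → ℕ ×ₗ ℕ} (hp : IsListing d p)
    (hp' : IsListing d' p') (h : hp.toSeq = hp'.toSeq) : d = d' ∧ p = p' := by
  refine ⟨?_, funext fun j => ofLex_inj.1 (Prod.ext ?_ ?_)⟩
  · rw [← hp.card_image_toSeq, ← hp'.card_image_toSeq, h]
  · have h1 := hp.card_image_toSeq_le j
    rw [h, hp'.card_image_toSeq_le j] at h1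
    omega
  · rw [← hp.card_image_toSeq_lt, ← hp'.card_image_toSeq_lt, h]

end IsListing

theorem IsProperSeq.exists_toSeq {n : ℕ} {a : Fin n → Fin n} (ha : IsProperSeq a) :
    ∃ (d : ℕ) (p : Fin n → ℕ ×ₗ ℕ) (hp : IsListing d p), hp.toSeq = a := by
  obtain ⟨hle, hprop⟩ := ha
  let V : Finset (Fin n) := Finset.univ.image a
  let rank : Fin n → ℕ := fun v => (V.filter (· < v)).card
  let upTo : Fin n → ℕ := fun v => (V.filter (· ≤ v)).card
  have haV : ∀ j, a j ∈ V := fun j => Finset.mem_image_of_mem a (Finset.mem_univ j)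
  have rank_mono : Monotone rank := fun u v huv => Finset.card_le_card fun w hw => by
    simp only [Finset.mem_filter] at hw ⊢
    exact ⟨hw.1, hw.2.trans_le huv⟩
  have upTo_mono : Monotone upTo := fun u v huv => Finset.card_le_card fun w hw => by
    simp only [Finset.mem_filter] at hw ⊢
    exact ⟨hw.1, hw.2.trans huv⟩
  have upTo_eq : ∀ v ∈ V, upTo v = rank v + 1 := by
    intro v hv
    have : V.filter (· ≤ v) = insert v (V.filter (· < v)) := by
      ext w
      simp only [Finset.mem_filter, Finset.mem_insert, le_iff_lt_or_eq]
      constructor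
      · rintro ⟨h1, h2 | h2⟩
        · exact Or.inr ⟨h1, h2⟩
        · exact Or.inl h2
      · rintro (rfl | h)
        · exact ⟨hv, Or.inr rfl⟩
        · exact ⟨h.1, Or.inl h.2⟩
    simp only [upTo, rank, this]
    rw [Finset.card_insert_of_notMem (by simp)]
  have upTo_le_rank : ∀ u v, u < v → upTo u ≤ rank v := fun u v huv =>
    Finset.card_le_card fun w hw => by
      simp only [Finset.mem_filter] at hw ⊢
      exact ⟨hw.1, hw.2.trans_lt huv⟩
  have upTo_gt : ∀ j, rank (a j) < upTo j := fun j => by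
    have h1 := upTo_eq _ (haV j)
    have h2 := upTo_mono (hle j)
    omega
  have upTo_le : ∀ j, upTo j ≤ V.card := fun j => Finset.card_filter_le _ _
  have rank_surj : V.image rank = Finset.range V.card := by
    refine Finset.eq_of_subset_of_card_le (fun x hx => ?_) ?_
    · obtain ⟨v, hv, rfl⟩ := Finset.mem_image.1 hx
      have h1 := upTo_eq v hv
      have h2 := upTo_le v
      rw [Finset.mem_range]
      omega
    · have hinj : Set.InjOn rank V := by
        intro u hu v hv huv
        have h1 := upTo_eq u hu
        have h2 := upTo_eq v hv
        rcases lt_trichotomy u v with h | h | h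
        · have := upTo_le_rank u v h
          omega
        · exact h
        · have := upTo_le_rank v u h
          omega
      rw [Finset.card_image_of_injOn hinj, Finset.card_range]
  have exists_rank : ∀ x < V.card, ∃ v ∈ V, rank v = x := fun x hx =>
    Finset.mem_image.1 (rank_surj ▸ Finset.mem_range.2 hx)
  let p : Fin n → ℕ ×ₗ ℕ := fun j => toLex (upTo j - 1, rank (a j))
  have p_succ_le : ∀ i j : Fin n, i.val + 1 = j.val → p i ≤ p j := by
    intro i j hij
    have hlt : i < j := by rw [Fin.lt_def]; omega
    rw [Prod.Lex.le_iff]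
    by_cases hj : j ∈ V
    · left
      have h1 := upTo_le_rank i j hlt
      have h2 := upTo_eq j hj
      have h3 := upTo_gt i
      simp only [p, ofLex_toLex]
      omega
    · have hai : a i ≤ a j := by
        by_contra h
        obtain ⟨l, hl⟩ := hprop i j hij (not_le.1 h)
        exact hj (hl ▸ haV l)
      have h1 := upTo_mono hlt.le
      have h2 := rank_mono hai
      simp only [p, ofLex_toLex]
      omega
  have hp : IsListing V.card p := by
    refine ⟨?_, fun j => ?_, fun x => ⟨fun hx => ?_, ?_⟩, fun y => ⟨fun hy => ?_, ?_⟩⟩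
    · cases n with
      | zero => exact fun i => i.elim0
      | succ m => exact Fin.monotone_iff_le_succ.2 fun i => p_succ_le _ _ (by simp)
    · have := upTo_gt j
      simp only [p, ofLex_toLex]
      omega
    · obtain ⟨v, hv, rfl⟩ := exists_rank x hx
      obtain ⟨j, -, rfl⟩ := Finset.mem_image.1 hv
      exact ⟨j, rfl⟩
    · rintro ⟨j, rfl⟩
      have h1 := upTo_gt j
      have h2 := upTo_le j
      simp only [p, ofLex_toLex]
      omega
    · obtain ⟨v, hv, rfl⟩ := exists_rank y hy
      refine ⟨v, ?_⟩
      have := upTo_eq v hv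
      simp only [p, ofLex_toLex]
      omega
    · rintro ⟨j, rfl⟩
      have h1 := upTo_gt j
      have h2 := upTo_le j
      simp only [p, ofLex_toLex]
      omega
  refine ⟨V.card, p, hp, funext fun j => Fin.ext ?_⟩
  have : (Finset.univ.filter fun i => (ofLex (p i)).1 < (ofLex (p j)).2) = Finset.Iio (a j) := by
    ext i
    simp only [Finset.mem_filter, Finset.mem_univ, true_and, Finset.mem_Iio]
    change upTo i - 1 < rank (a j) ↔ i < a j
    have h1 := upTo_gt i
    constructor
    · intro h
      by_contra hc
      have h2 := upTo_mono (not_lt.1 hc)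
      have h3 := upTo_eq _ (haV j)
      omega
    · intro h
      have := upTo_le_rank _ _ h
      omega
  change (Finset.univ.filter fun i => (ofLex (p i)).1 < (ofLex (p j)).2).card = _
  rw [this, Fin.card_Iio]

/-- The listings of the units of the matrices in `I_{n,k}`. -/
abbrev Listing (n k : ℕ) : Type :=
  {q : ℕ × (Fin n → ℕ ×ₗ ℕ) // IsListing q.1 q.2 ∧
    (Finset.univ.filter fun j => (ofLex (q.2 j)).2 = 0).card = k}

theorem nonempty_listing_equiv_memI (n k : ℕ) :
    Nonempty (Listing n k ≃ {A : SqMat // MemI n A ∧ A.rsum 0 = k}) := by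
  refine ⟨Equiv.ofBijective (fun q => ⟨ofListing q.1.1 q.1.2, q.2.1.memI_ofListing,
    (q.2.1.rsum_ofListing 0).trans q.2.2⟩) ⟨fun q q' h => ?_, ?_⟩⟩
  · obtain ⟨h1, h2⟩ := q.2.1.eq_of_ofListing_eq q'.2.1 (congrArg Subtype.val h)
    exact Subtype.ext (Prod.ext h1 h2)
  · rintro ⟨B, hB, hk⟩
    obtain ⟨p, hp, e⟩ := hB.exists_ofListing
    refine ⟨⟨(B.1, p), hp, ?_⟩, Subtype.ext e.symm⟩
    rw [← hk, ← hp.rsum_ofListing 0, ← e]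

theorem nonempty_listing_equiv_memPM (n k : ℕ) :
    Nonempty (Listing n k ≃ {A : SqMat // MemPM n A ∧ A.rsum 0 = k}) := by
  have hr : ∀ {d : ℕ} {p : Fin n → ℕ ×ₗ ℕ} (hp : IsListing d p), (ofSeq hp.toSeq).rsum 0
      = (Finset.univ.filter fun j => (ofLex (p j)).2 = 0).card := by
    intro d p hp
    rw [rsum_ofSeq]
    simp only [hp.toSeq_eq_zero_iff]
  refine ⟨Equiv.ofBijective (fun q => ⟨ofSeq q.2.1.toSeq,
    (memPM_ofSeq_iff _).2 q.2.1.isProperSeq_toSeq, (hr q.2.1).trans q.2.2⟩)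
    ⟨fun q q' h => ?_, ?_⟩⟩
  · obtain ⟨h1, h2⟩ := q.2.1.eq_of_toSeq_eq q'.2.1 (ofSeq_injective (congrArg Subtype.val h))
    exact Subtype.ext (Prod.ext h1 h2)
  · rintro ⟨A, hA, hk⟩
    obtain ⟨a, rfl⟩ := hA.exists_ofSeq
    obtain ⟨d, p, hp, rfl⟩ := ((memPM_ofSeq_iff a).1 hA).exists_toSeq
    exact ⟨⟨(d, p), hp, (hr hp).symm.trans hk⟩, rfl⟩

end SqMat

/-- For all positive integers `n` and all `k ≥ 0`, the number of matrices
in `PM_n` whose first row sums to `k` equals the number of matrices in `I_n` whose first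
row sums to `k`; that is, there is a bijection between `PM_{n,k}` and `I_{n,k}`. -/
theorem proper_card_eq_intMat_card (n k : ℕ) (hn : 0 < n) :
    {A : SqMat | SqMat.MemPM n A ∧ A.rsum 0 = k}.ncard
      = {A : SqMat | SqMat.MemI n A ∧ A.rsum 0 = k}.ncard ∧
    Nonempty ({A : SqMat // SqMat.MemPM n A ∧ A.rsum 0 = k}
      ≃ {A : SqMat // SqMat.MemI n A ∧ A.rsum 0 = k}) := by
  obtain ⟨e⟩ := SqMat.nonempty_listing_equiv_memPM n k
  obtain ⟨f⟩ := SqMat.nonempty_listing_equiv_memI n k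
  exact ⟨Nat.card_congr (e.symm.trans f), ⟨e.symm.trans f⟩⟩
end

section
/- For every positive integer n, Σ over matrices A in I_n of z^{rsum_1(A)} equals the coefficient of t^n in the polynomial Σ_{m=0}^{n} ∏_{i=1}^{m} ( 1 − (1−t)^{i−1}(1−zt) ), viewed as a polynomial in t with coefficients in ℤ[z]. -/
open Polynomial

/-- The operator `φ ↦ (k ↦ a (k + 1) φ (k + 1) - a k φ k)` on sequences. -/
def weightedDiff {A : Type*} [CommRing A] (a φ : ℕ → A) (k : ℕ) : A :=
  a (k + 1) * φ (k + 1) - a k * φ k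

section WeightedDiff

variable {A : Type*} [CommRing A] (a : ℕ → A)

theorem sum_powerset_range_prod_eq_weightedDiff_iterate (d : ℕ) (φ : ℕ → A) :
    ∑ S ∈ (Finset.range d).powerset, (-1) ^ S.card *
        ((∏ j ∈ Finset.range (d + 1), a (Finset.range j \ S).card) *
          φ (Finset.range d \ S).card)
      = a 0 * (weightedDiff a)^[d] φ 0 := by
  induction d generalizing φ with
  | zero => simp
  | succ d ih =>
    rw [Finset.range_add_one (n := d), Finset.sum_powerset_insert (by simp),
      Function.iterate_succ_apply, ← ih, ← Finset.sum_add_distrib]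
    refine Finset.sum_congr rfl fun S hS => ?_
    have hd : d ∉ S := fun h => by simpa using Finset.mem_powerset.1 hS h
    have h₁ : (insert d (Finset.range d) \ S).card = (Finset.range d \ S).card + 1 := by
      rw [Finset.insert_sdiff_of_notMem _ hd, Finset.card_insert_of_notMem (by simp)]
    have h₂ : insert d (Finset.range d) \ insert d S = Finset.range d \ S := by
      ext x; simp; grind
    have h₃ : ∏ j ∈ Finset.range (d + 1), a (Finset.range j \ insert d S).card
        = ∏ j ∈ Finset.range (d + 1), a (Finset.range j \ S).card := by
      refine Finset.prod_congr rfl fun j hj => ?_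
      congr 2
      ext x; simp at hj ⊢; grind
    rw [Finset.prod_range_succ _ (d + 1), Finset.prod_range_succ _ (d + 1),
      Finset.range_add_one (n := d), h₁, h₂, ← Finset.range_add_one (n := d), h₃,
      Finset.card_insert_of_notMem hd]
    simp only [weightedDiff]
    ring

theorem pow_dvd_weightedDiff_iterate {x : A} (ha : ∀ k, x ∣ a k) (φ : ℕ → A) (N k : ℕ) :
    x ^ N ∣ (weightedDiff a)^[N] φ k := by
  induction N generalizing k with
  | zero => simp
  | succ N ih =>
    rw [Function.iterate_succ_apply', weightedDiff, pow_succ']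
    exact dvd_sub (mul_dvd_mul (ha _) (ih _)) (mul_dvd_mul (ha _) (ih _))

theorem sum_weightedDiff_iterate_succ (N k : ℕ) :
    ∑ d ∈ Finset.range (N + 1), (weightedDiff a)^[d] 1 k
      = 1 + weightedDiff a (fun l => ∑ d ∈ Finset.range N, (weightedDiff a)^[d] 1 l) k := by
  rw [Finset.sum_range_succ', add_comm]
  simp only [Function.iterate_succ_apply', weightedDiff, Finset.mul_sum,
    ← Finset.sum_sub_distrib, Function.iterate_zero, id, Pi.one_apply]

theorem pow_succ_dvd_mul_sum_weightedDiff_sub {x : A} {q : ℕ → A} (ha : ∀ k, x ∣ a k)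
    (hq : ∀ k, q k * (1 + a k) = 1) (N k : ℕ) :
    x ^ (N + 1) ∣ a k * ∑ d ∈ Finset.range N, (weightedDiff a)^[d] 1 k
      - ∑ m ∈ Finset.range N, ∏ i ∈ Finset.range (m + 1), (1 - q (k + i)) := by
  induction N generalizing k with
  | zero => simp
  | succ N ih =>
    have hc : 1 - q k = a k * q k := by linear_combination -hq k
    have hs := sum_weightedDiff_iterate_succ a N k
    have hs' := Finset.sum_range_succ (fun d => (weightedDiff a)^[d] 1 k) N
    have hr : ∑ m ∈ Finset.range (N + 1), ∏ i ∈ Finset.range (m + 1), (1 - q (k + i))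
        = (1 - q k) * (1 + ∑ m ∈ Finset.range N, ∏ i ∈ Finset.range (m + 1),
            (1 - q (k + 1 + i))) := by
      rw [Finset.sum_range_succ', mul_add, Finset.mul_sum, add_comm, mul_one]
      congr 1
      · simp
      · refine Finset.sum_congr rfl fun m _ => ?_
        rw [Finset.prod_range_succ', mul_comm, add_zero]
        simp only [add_assoc, add_comm 1]
    simp only [weightedDiff] at hs
    set E := ∑ d ∈ Finset.range (N + 1), (weightedDiff a)^[d] 1 k
    set E₀ := ∑ d ∈ Finset.range N, (weightedDiff a)^[d] 1 k
    set E₁ := ∑ d ∈ Finset.range N, (weightedDiff a)^[d] 1 (k + 1)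
    set P := ∑ m ∈ Finset.range N, ∏ i ∈ Finset.range (m + 1), (1 - q (k + 1 + i))
    obtain ⟨u, hu⟩ := ih (k + 1)
    obtain ⟨v, hv⟩ := pow_dvd_weightedDiff_iterate a ha 1 N k
    obtain ⟨b, hb⟩ := ha k
    refine ⟨b * q k * u + b * q k * b * v, ?_⟩
    have key : a k * E - (1 - q k) * (1 + P)
        = a k * q k * (a (k + 1) * E₁ - P) + a k * q k * a k * (weightedDiff a)^[N] 1 k := by
      linear_combination (a k * q k) * hs + (a k * q k * a k) * hs' - (a k * E) * hq k
        - (1 + P) * hc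
    rw [hr, key, hu, hv, hb]
    ring

end WeightedDiff

section InclusionExclusion

variable {R ι κ : Type*} [CommRing R]

theorem ite_forall_exists_ne_zero_eq_sum (I : Finset ι) (s : Finset κ) (B : ι → κ → Prop)
    [∀ i, DecidablePred (B i)] (f : κ → ℕ) :
    (if ∀ i ∈ I, ∃ p ∈ s, B i p ∧ f p ≠ 0 then (1 : R) else 0)
      = ∑ S ∈ I.powerset, (-1) ^ S.card *
          ∏ p ∈ s, if (∃ i ∈ S, B i p) → f p = 0 then 1 else 0 := by
  have h : ∀ i, (if ∃ p ∈ s, B i p ∧ f p ≠ 0 then (1 : R) else 0)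
      = 1 - if ∀ p ∈ s, B i p → f p = 0 then 1 else 0 := by
    intro i
    by_cases hi : ∃ p ∈ s, B i p ∧ f p ≠ 0
    · have : ¬ ∀ p ∈ s, B i p → f p = 0 := by push Not; exact hi
      simp [hi, this]
    · have : ∀ p ∈ s, B i p → f p = 0 := by push Not at hi; exact hi
      rw [if_neg hi, if_pos this, sub_self]
  classical
  calc _ = ∏ i ∈ I, (if ∃ p ∈ s, B i p ∧ f p ≠ 0 then (1 : R) else 0) := by
        rw [Finset.prod_ite_zero, Finset.prod_const_one]
    _ = _ := by
        simp_rw [h, Finset.prod_sub, Finset.prod_const_one, mul_one, Finset.prod_ite_zero,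
          Finset.prod_const_one]
        refine Finset.sum_congr rfl fun S _ => ?_
        congr 2
        exact propext ⟨fun h p hp ⟨i, hi, hB⟩ => h i hi p hp hB,
          fun h i hi p hp hB => h p hp ⟨i, hi, hB⟩⟩

theorem sum_finsuppAntidiag_filter_eq {ι' : Type*} [DecidableEq κ] (I : Finset ι) (J : Finset ι')
    (s : Finset κ) (B : ι → κ → Prop) (B' : ι' → κ → Prop)
    [∀ i, DecidablePred (B i)] [∀ j, DecidablePred (B' j)] (w : κ → R) (n : ℕ) :
    ∑ f ∈ s.finsuppAntidiag n with
        (∀ i ∈ I, ∃ p ∈ s, B i p ∧ f p ≠ 0) ∧ (∀ j ∈ J, ∃ p ∈ s, B' j p ∧ f p ≠ 0),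
        ∏ p ∈ s, w p ^ f p
      = PowerSeries.coeff n (∑ S ∈ I.powerset, ∑ T ∈ J.powerset,
          (-1) ^ S.card * ((-1) ^ T.card * ∏ p ∈ s,
            if (∃ i ∈ S, B i p) ∨ (∃ j ∈ T, B' j p) then 1
            else PowerSeries.mk (w p ^ ·))) := by
  have hcoeff : ∀ (k : ℕ) (g : PowerSeries R),
      PowerSeries.coeff n ((-1) ^ k * g) = (-1) ^ k * PowerSeries.coeff n g := by
    intro k g
    rw [show ((-1) ^ k : PowerSeries R) = PowerSeries.C ((-1) ^ k) by simp,
      PowerSeries.coeff_C_mul]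
  simp_rw [map_sum, hcoeff, PowerSeries.coeff_prod, Finset.mul_sum]
  rw [Finset.sum_filter]
  simp_rw [Finset.sum_comm (t := s.finsuppAntidiag n)]
  refine Finset.sum_congr rfl fun f _ => ?_
  rw [← mul_boole, ite_and, ← mul_boole, mul_comm (ite _ _ _) (ite _ _ _),
    ite_forall_exists_ne_zero_eq_sum, ite_forall_exists_ne_zero_eq_sum, Finset.sum_mul_sum,
    Finset.mul_sum]
  refine Finset.sum_congr rfl fun S _ => ?_
  rw [Finset.mul_sum]
  refine Finset.sum_congr rfl fun T _ => ?_
  rw [mul_mul_mul_comm, ← Finset.prod_mul_distrib, mul_left_comm, ← Finset.prod_mul_distrib,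
    mul_assoc]
  congr 2
  refine Finset.prod_congr rfl fun p _ => ?_
  by_cases h₁ : ∃ i ∈ S, B i p <;> by_cases h₂ : ∃ j ∈ T, B' j p <;>
    by_cases h₃ : f p = 0 <;> simp [h₁, h₂, h₃, PowerSeries.coeff_one]

end InclusionExclusion

namespace SqMat

/-- The cells of an upper triangular matrix of dimension `d + 1`, as pairs `(column, row)`. -/
def triCells (d : ℕ) : Finset (ℕ × ℕ) :=
  {p ∈ Finset.range (d + 1) ×ˢ Finset.range (d + 1) | p.2 ≤ p.1}

/-- The weight of a unit placed in a cell: `X` in the first row and `1` elsewhere. -/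
noncomputable def cellWeight (p : ℕ × ℕ) : Polynomial ℤ := if p.2 = 0 then X else 1

/-- The weight series of the nonzero columns having their nonzero entries in the first row or
in one of `k` other given rows. -/
noncomputable def columnSeries (k : ℕ) : PowerSeries (Polynomial ℤ) :=
  PowerSeries.mk (X ^ ·) * PowerSeries.mk 1 ^ k - 1

/-- The square matrix of dimension `d + 1` with entry `f (c, r)` in row `r` and column `c`. -/
def ofCells (d : ℕ) (f : ℕ × ℕ →₀ ℕ) : SqMat :=
  ⟨d + 1, fun r c => f (c, r)⟩

/-- The filling has no zero column and, except possibly for the first row, no zero row. -/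
def NoZeroLine (d : ℕ) (f : ℕ × ℕ →₀ ℕ) : Prop :=
  (∀ i ∈ Finset.range d, ∃ p ∈ triCells d, p.2 = i + 1 ∧ f p ≠ 0) ∧
    ∀ j ∈ Finset.range (d + 1), ∃ p ∈ triCells d, p.1 = j ∧ f p ≠ 0

open Classical in
/-- The fillings of `triCells d` with sum `n` and `NoZeroLine`. -/
noncomputable def fishburnFillings (n d : ℕ) : Finset (ℕ × ℕ →₀ ℕ) :=
  {f ∈ (triCells d).finsuppAntidiag n | NoZeroLine d f}

theorem mem_fishburnFillings {n d : ℕ} {f : ℕ × ℕ →₀ ℕ} :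
    f ∈ fishburnFillings n d ↔ f ∈ (triCells d).finsuppAntidiag n ∧ NoZeroLine d f := by
  classical
  exact Finset.mem_filter

theorem mem_triCells {d : ℕ} {p : ℕ × ℕ} : p ∈ triCells d ↔ p.1 ≤ d ∧ p.2 ≤ p.1 := by
  simp only [triCells, Finset.mem_filter, Finset.mem_product, Finset.mem_range]
  omega

theorem mem_triCells_iff_mem_range {d : ℕ} (p : ℕ × ℕ) :
    p ∈ triCells d ↔ p.1 ∈ Finset.range (d + 1) ∧ p.2 ∈ Finset.range (p.1 + 1) := by
  simp only [mem_triCells, Finset.mem_range, Nat.lt_succ_iff]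

theorem ent_eq_zero_of_dim_le {A : SqMat} {r c : ℕ} (h : A.1 ≤ r ∨ A.1 ≤ c) : A.ent r c = 0 :=
  dif_neg (by omega)

section OfCells

variable {d : ℕ} {f : ℕ × ℕ →₀ ℕ}

theorem ent_ofCells (hf : f.support ⊆ triCells d) (r c : ℕ) :
    (ofCells d f).ent r c = f (c, r) := by
  unfold ent
  split_ifs with h
  · rfl
  · by_contra h0
    have := mem_triCells.1 (hf (Finsupp.mem_support_iff.2 (Ne.symm h0)))
    simp only [ofCells] at h this
    omega

theorem sum_triCells_eq_total (hf : f.support ⊆ triCells d) :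
    ∑ p ∈ triCells d, f p = (ofCells d f).total := by
  unfold total rsum
  rw [Finset.sum_finset_product _ (Finset.range (d + 1)) (fun j => Finset.range (j + 1))
    mem_triCells_iff_mem_range, Finset.sum_comm]
  simp_rw [ent_ofCells hf]
  refine Finset.sum_congr rfl fun c hc => Finset.sum_subset ?_ fun r _ hr => ?_
  · exact Finset.range_subset_range.2 (Finset.mem_range.1 hc)
  · by_contra h0
    have := mem_triCells.1 (hf (Finsupp.mem_support_iff.2 h0))
    simp at hr this
    omega

theorem prod_cellWeight_pow (hf : f.support ⊆ triCells d) :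
    ∏ p ∈ triCells d, cellWeight p ^ f p = X ^ (ofCells d f).rsum 0 := by
  unfold rsum
  simp_rw [ent_ofCells hf]
  rw [Finset.prod_finset_product _ (Finset.range (d + 1)) (fun j => Finset.range (j + 1))
    mem_triCells_iff_mem_range, ← Finset.prod_pow_eq_pow_sum]
  refine Finset.prod_congr rfl fun c _ => ?_
  rw [Finset.prod_range_succ']
  simp [cellWeight]

theorem rsum_ofCells_pos_iff (hf : f.support ⊆ triCells d) (r : ℕ) :
    0 < (ofCells d f).rsum r ↔ ∃ p ∈ triCells d, p.2 = r ∧ f p ≠ 0 := by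
  unfold rsum
  simp_rw [Nat.pos_iff_ne_zero, ne_eq, Finset.sum_eq_zero_iff, ent_ofCells hf]
  constructor
  · intro h
    push Not at h
    obtain ⟨c, -, hc⟩ := h
    exact ⟨(c, r), hf (Finsupp.mem_support_iff.2 hc), rfl, hc⟩
  · rintro ⟨p, hp, rfl, h0⟩ h
    exact h0 (h p.1 (Finset.mem_range.2 (Nat.lt_succ_of_le (mem_triCells.1 hp).1)))

theorem csum_ofCells_pos_iff (hf : f.support ⊆ triCells d) (c : ℕ) :
    0 < (ofCells d f).csum c ↔ ∃ p ∈ triCells d, p.1 = c ∧ f p ≠ 0 := by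
  unfold csum
  simp_rw [Nat.pos_iff_ne_zero, ne_eq, Finset.sum_eq_zero_iff, ent_ofCells hf]
  constructor
  · intro h
    push Not at h
    obtain ⟨r, -, hr⟩ := h
    exact ⟨(c, r), hf (Finsupp.mem_support_iff.2 hr), rfl, hr⟩
  · rintro ⟨p, hp, rfl, h0⟩ h
    have := mem_triCells.1 hp
    exact h0 (h p.2 (Finset.mem_range.2 (Nat.lt_succ_of_le (this.2.trans this.1))))

theorem memI_ofCells_iff (hf : f.support ⊆ triCells d) (n : ℕ) :
    MemI n (ofCells d f) ↔ f ∈ fishburnFillings n d := by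
  have hU : UpperTri (ofCells d f) := by
    intro r c h
    rw [ent_ofCells hf]
    by_contra h0
    have := (mem_triCells.1 (hf (Finsupp.mem_support_iff.2 h0))).2
    simp only at this
    omega
  simp only [MemI, mem_fishburnFillings, NoZeroLine, Finset.mem_finsuppAntidiag, hf, and_true,
    RowsNonzero, ColsNonzero, rsum_ofCells_pos_iff hf, csum_ofCells_pos_iff hf, hU, true_and,
    sum_triCells_eq_total hf, Finset.mem_range]
  refine and_congr_right fun _ => ⟨fun ⟨h₁, h₂⟩ => ⟨fun i hi => h₁ (i + 1) (Nat.succ_lt_succ hi),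
    h₂⟩, fun ⟨h₁, h₂⟩ => ⟨fun i hi => ?_, h₂⟩⟩
  cases i with
  | succ i => exact h₁ i (Nat.lt_of_succ_lt_succ hi)
  | zero =>
    obtain ⟨p, hp, hp0, h0⟩ := h₂ 0 (Nat.succ_pos d)
    exact ⟨p, hp, Nat.le_zero.1 (hp0 ▸ (mem_triCells.1 hp).2), h0⟩

end OfCells

theorem UpperTri.exists_ofCells_eq {d : ℕ} {M : Matrix (Fin (d + 1)) (Fin (d + 1)) ℕ}
    (h : UpperTri ⟨d + 1, M⟩) : ∃ f, f.support ⊆ triCells d ∧ ofCells d f = ⟨d + 1, M⟩ := by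
  refine ⟨Finsupp.onFinset (triCells d) (fun p => ent ⟨d + 1, M⟩ p.2 p.1) fun p hp => ?_,
    Finsupp.support_onFinset_subset, ?_⟩
  · rw [mem_triCells]
    by_contra hn
    refine hp ?_
    by_cases hlt : p.1 < p.2
    · exact h _ _ hlt
    · exact ent_eq_zero_of_dim_le (Or.inr (by simp only; omega))
  · unfold ofCells
    congr 1
    ext r c
    exact dif_pos ⟨r.2, c.2⟩

theorem dim_le_of_memI {n : ℕ} {A : SqMat} (h : MemI n A) : A.1 ≤ n := by
  obtain ⟨-, rfl, hr, -⟩ := h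
  calc A.1 = ∑ _i ∈ Finset.range A.1, 1 := by simp
    _ ≤ A.total := Finset.sum_le_sum fun i hi => hr i (Finset.mem_range.1 hi)

theorem finsum_memI_eq_sum (n : ℕ) (hn : 0 < n) :
    (∑ᶠ A ∈ {A : SqMat | MemI n A}, (X : Polynomial ℤ) ^ A.rsum 0)
      = ∑ d ∈ Finset.range n, ∑ f ∈ fishburnFillings n d,
          ∏ p ∈ triCells d, cellWeight p ^ f p := by
  have hsupp : ∀ {d f}, f ∈ fishburnFillings n d → f.support ⊆ triCells d := by
    intro d f h
    rw [mem_fishburnFillings, Finset.mem_finsuppAntidiag] at h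
    exact h.1.2
  rw [← Finset.sum_sigma (Finset.range n) (fishburnFillings n)
    (fun x => ∏ p ∈ triCells x.1, cellWeight p ^ x.2 p), ← finsum_mem_coe_finset]
  refine (finsum_mem_eq_of_bijOn (fun x => ofCells x.1 x.2) ⟨?_, ?_, ?_⟩ ?_).symm
  · rintro ⟨d, f⟩ hx
    have hx := (Finset.mem_sigma.1 hx).2
    exact (memI_ofCells_iff (hsupp hx) n).2 hx
  · rintro ⟨d, f⟩ hx ⟨d', f'⟩ hx' h
    have hx := hsupp (Finset.mem_sigma.1 hx).2
    have hx' := hsupp (Finset.mem_sigma.1 hx').2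
    simp only at h hx hx'
    obtain rfl : d = d' := Nat.succ_injective (congrArg Sigma.fst h)
    congr 1
    ext ⟨c, r⟩
    rw [← ent_ofCells hx, ← ent_ofCells hx', h]
  · rintro ⟨D, M⟩ hA
    have hA' : MemI n ⟨D, M⟩ := hA
    cases D with
    | zero =>
      have := hA'.2.1
      simp [total] at this
      omega
    | succ d =>
      obtain ⟨f, hf, hfM⟩ := hA'.1.exists_ofCells_eq
      refine ⟨⟨d, f⟩, Finset.mem_sigma.2 ⟨Finset.mem_range.2 (dim_le_of_memI hA'), ?_⟩, hfM⟩
      exact (memI_ofCells_iff hf n).1 (hfM ▸ hA')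
  · rintro ⟨d, f⟩ hx
    exact prod_cellWeight_pow (hsupp (Finset.mem_sigma.1 hx).2)

theorem mk_pow_mul_one_sub {R : Type*} [CommRing R] (w : R) :
    PowerSeries.mk (w ^ ·) * (1 - PowerSeries.C w * PowerSeries.X) = 1 := by
  ext n
  cases n with
  | zero => simp
  | succ n =>
    rw [mul_sub, mul_one, mul_left_comm, ← mul_assoc, map_sub, PowerSeries.coeff_succ_mul_X]
    simp [PowerSeries.coeff_one, pow_succ']

theorem X_dvd_columnSeries (k : ℕ) : PowerSeries.X ∣ columnSeries k := by
  rw [PowerSeries.X_dvd_iff]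
  have h : ∀ g : ℕ → Polynomial ℤ, PowerSeries.constantCoeff (PowerSeries.mk g) = g 0 := fun g => by
    rw [← PowerSeries.coeff_zero_eq_constantCoeff_apply, PowerSeries.coeff_mk]
  simp [columnSeries, h]

theorem mul_one_add_columnSeries (k : ℕ) :
    (1 - PowerSeries.X) ^ k * (1 - PowerSeries.C X * PowerSeries.X) * (1 + columnSeries k)
      = 1 := by
  have h₁ := mk_pow_mul_one_sub (X : Polynomial ℤ)
  have h₂ := PowerSeries.mk_one_mul_one_sub_eq_one (Polynomial ℤ)
  rw [columnSeries, add_sub_cancel, mul_comm (PowerSeries.mk _), mul_mul_mul_comm, ← mul_pow,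
    mul_comm (1 - PowerSeries.X), h₂, mul_comm (1 - _), h₁, one_pow, one_mul]

theorem sum_powerset_prod_triCells (d : ℕ) (S : Finset ℕ) :
    ∑ T ∈ (Finset.range (d + 1)).powerset, (-1) ^ T.card * ∏ p ∈ triCells d,
        (if (∃ i ∈ S, p.2 = i + 1) ∨ (∃ j ∈ T, p.1 = j) then 1
          else PowerSeries.mk (cellWeight p ^ ·))
      = ∏ j ∈ Finset.range (d + 1), columnSeries (Finset.range j \ S).card := by
  simp only [columnSeries, Finset.prod_sub, Finset.prod_const_one, mul_one]
  refine Finset.sum_congr rfl fun T _ => ?_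
  rw [Finset.prod_finset_product _ (Finset.range (d + 1)) (fun j => Finset.range (j + 1))
    mem_triCells_iff_mem_range, ← Finset.filter_notMem_eq_sdiff, Finset.prod_filter]
  congr 1
  refine Finset.prod_congr rfl fun j _ => ?_
  by_cases hj : j ∈ T
  · simp [hj]
  · rw [if_pos hj, Finset.prod_range_succ', mul_comm, ← Finset.filter_notMem_eq_sdiff,
      ← Finset.prod_const, Finset.prod_filter]
    have h₁ : PowerSeries.mk (fun _ : ℕ => (1 : Polynomial ℤ)) = PowerSeries.mk 1 := rfl
    simp [hj, cellWeight, h₁]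

theorem sum_fishburnFillings (n d : ℕ) :
    ∑ f ∈ fishburnFillings n d, ∏ p ∈ triCells d, cellWeight p ^ f p
      = PowerSeries.coeff n (columnSeries 0 * (weightedDiff columnSeries)^[d] 1 0) := by
  rw [← sum_powerset_range_prod_eq_weightedDiff_iterate]
  have key := sum_finsuppAntidiag_filter_eq (Finset.range d) (Finset.range (d + 1)) (triCells d)
    (fun i p => p.2 = i + 1) (fun j p => p.1 = j) cellWeight n
  refine (Finset.sum_congr ?_ fun _ _ => rfl).trans (key.trans ?_)
  · ext f
    rw [mem_fishburnFillings, Finset.mem_filter]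
    rfl
  congr 1
  refine Finset.sum_congr rfl fun S _ => ?_
  rw [← Finset.mul_sum, Pi.one_apply, mul_one, ← sum_powerset_prod_triCells]

end SqMat
/-- For every positive integer `n`, `Σ_{A ∈ I_n} z^{rsum_1 A}` equals the
coefficient of `t^n` in the polynomial `Σ_{m=0}^{n} ∏_{i=1}^{m} (1 - (1-t)^{i-1}(1-zt))`.
On the left, `X : Polynomial ℤ` plays the role of `z`; on the right, the outer variable
`X : Polynomial (Polynomial ℤ)` plays the role of `t` and `C X` the role of `z`, with the
product index `i ∈ Finset.range m` corresponding to the paper's `i+1`. -/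
theorem weight_intMat_eq_coeff (n : ℕ) (hn : 0 < n) :
    (∑ᶠ A ∈ {A : SqMat | SqMat.MemI n A}, (X : Polynomial ℤ) ^ A.rsum 0)
    = (∑ m ∈ Finset.range (n + 1), ∏ i ∈ Finset.range m,
        ((1 : Polynomial (Polynomial ℤ))
          - (1 - X) ^ i * (1 - C X * X))).coeff n := by
  have h := pow_succ_dvd_mul_sum_weightedDiff_sub SqMat.columnSeries SqMat.X_dvd_columnSeries
    SqMat.mul_one_add_columnSeries n 0
  have hc := PowerSeries.X_pow_dvd_iff.1 h n n.lt_succ_self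
  rw [map_sub, sub_eq_zero] at hc
  rw [SqMat.finsum_memI_eq_sum n hn]
  simp_rw [SqMat.sum_fishburnFillings]
  rw [← map_sum, ← Finset.mul_sum, hc, Finset.sum_range_succ', Polynomial.coeff_add,
    Finset.prod_range_zero, Polynomial.coeff_one, if_neg hn.ne', add_zero, ← Polynomial.coeff_coe,
    ← Polynomial.coeToPowerSeries.ringHom_apply]
  simp only [map_sum, map_prod, map_sub, map_mul, map_pow, map_one, zero_add,
    Polynomial.coeToPowerSeries.ringHom_apply, Polynomial.coe_X, Polynomial.coe_C]
end

section
/- For every positive integer n, the number of matrices in I_n equals the coefficient of t^n in the polynomial Σ_{m=0}^{n} ∏_{i=1}^{m} ( 1 − (1−t)^{i} ), viewed as a polynomial in t with integer coefficients. -/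
open Polynomial

/-- The signed weight of a set `T` of rows allowed to be nonzero, among the first `d` rows. -/
def rowSetWeight {R : Type*} [CommRing R] (E : R) (d : ℕ) (T : Finset ℕ) : R :=
  ∏ j ∈ Finset.range d, ((if j ∈ T then 1 else -1) * (E ^ (T.filter (· ≤ j)).card - 1))

/-- The sum of the weights of all `k`-element sets of rows among the first `d` rows. -/
def rowSetSum {R : Type*} [CommRing R] (E : R) (d k : ℕ) : R :=
  ∑ T ∈ Finset.powersetCard k (Finset.range d), rowSetWeight E d T

section Weights

variable {R : Type*} [CommRing R]

lemma rowSetWeight_succ_of_subset (E : R) {d : ℕ} {T : Finset ℕ} (hT : T ⊆ Finset.range d) :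
    rowSetWeight E (d + 1) T = -(rowSetWeight E d T * (E ^ T.card - 1)) := by
  have h1 : d ∉ T := fun h => by simpa using hT h
  have h2 : T.filter (· ≤ d) = T :=
    Finset.filter_true_of_mem fun x hx => (Finset.mem_range.1 (hT hx)).le
  rw [rowSetWeight, Finset.prod_range_succ, h2, if_neg h1, ← rowSetWeight]
  ring

lemma rowSetWeight_succ_insert (E : R) {d : ℕ} {T : Finset ℕ} (hT : T ⊆ Finset.range d) :
    rowSetWeight E (d + 1) (insert d T) = rowSetWeight E d T * (E ^ (T.card + 1) - 1) := by
  have h1 : d ∉ T := fun h => by simpa using hT h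
  have h2 : (insert d T).filter (· ≤ d) = insert d T :=
    Finset.filter_true_of_mem fun x hx => by
      rcases Finset.mem_insert.1 hx with rfl | hx
      · exact le_rfl
      · exact (Finset.mem_range.1 (hT hx)).le
  rw [rowSetWeight, Finset.prod_range_succ, h2, if_pos (Finset.mem_insert_self _ _),
    Finset.card_insert_of_notMem h1, one_mul, rowSetWeight]
  congr 1
  refine Finset.prod_congr rfl fun j hj => ?_
  have hj' := Finset.mem_range.1 hj
  rw [Finset.filter_insert, if_neg (show ¬d ≤ j by omega)]
  simp [Finset.mem_insert, hj'.ne]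

lemma rowSetSum_succ_succ (E : R) (d k : ℕ) :
    rowSetSum E (d + 1) (k + 1) =
      (rowSetSum E d k - rowSetSum E d (k + 1)) * (E ^ (k + 1) - 1) := by
  have hd : d ∉ Finset.range d := by simp
  rw [rowSetSum, Finset.range_add_one, Finset.powersetCard_succ_insert hd, Finset.sum_union,
    Finset.sum_image]
  · have h1 : ∀ T ∈ Finset.powersetCard (k + 1) (Finset.range d),
        rowSetWeight E (d + 1) T = -(rowSetWeight E d T * (E ^ (k + 1) - 1)) := fun T hT => by
      rw [Finset.mem_powersetCard] at hT
      rw [rowSetWeight_succ_of_subset E hT.1, hT.2]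
    have h2 : ∀ T ∈ Finset.powersetCard k (Finset.range d),
        rowSetWeight E (d + 1) (insert d T) = rowSetWeight E d T * (E ^ (k + 1) - 1) :=
      fun T hT => by
        rw [Finset.mem_powersetCard] at hT
        rw [rowSetWeight_succ_insert E hT.1, hT.2]
    rw [Finset.sum_congr rfl h1, Finset.sum_congr rfl h2, Finset.sum_neg_distrib,
      ← Finset.sum_mul, ← Finset.sum_mul, ← rowSetSum, ← rowSetSum]
    ring
  · intro S hS T hT h
    have hS' : d ∉ S := fun h => hd ((Finset.mem_powersetCard.1 hS).1 h)
    have hT' : d ∉ T := fun h => hd ((Finset.mem_powersetCard.1 hT).1 h)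
    rw [← Finset.erase_insert hS', ← Finset.erase_insert hT']
    exact congrArg (fun U => Finset.erase U d) h
  · rw [Finset.disjoint_left]
    intro S hS hS'
    obtain ⟨T, -, rfl⟩ := Finset.mem_image.1 hS'
    exact hd ((Finset.mem_powersetCard.1 hS).1 (Finset.mem_insert_self _ _))

lemma rowSetSum_zero_zero (E : R) : rowSetSum E 0 0 = 1 := by
  simp [rowSetSum, rowSetWeight]

lemma rowSetSum_succ_zero (E : R) (d : ℕ) : rowSetSum E (d + 1) 0 = 0 := by
  simp [rowSetSum, rowSetWeight, Finset.prod_range_succ]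

lemma rowSetSum_eq_zero_of_lt (E : R) {d k : ℕ} (h : d < k) : rowSetSum E d k = 0 := by
  rw [rowSetSum, Finset.powersetCard_eq_empty.2 (by simpa using h), Finset.sum_empty]

lemma pow_dvd_rowSetSum {E t : R} (h : t ∣ E - 1) (d k : ℕ) : t ^ d ∣ rowSetSum E d k := by
  refine Finset.dvd_sum fun T _ => ?_
  have key : ∏ _j ∈ Finset.range d, t ∣ rowSetWeight E d T :=
    Finset.prod_dvd_prod_of_dvd _ _ fun j _ =>
      (h.trans (by simpa using sub_dvd_pow_sub_pow E 1 _)).mul_left _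
  simpa using key

lemma sum_rowSetSum_eq_prod {E t : R} {n : ℕ} (ht : t ^ (n + 1) = 0) (hE : E * (1 - t) = 1)
    (k : ℕ) :
    ∑ d ∈ Finset.range (n + 1), rowSetSum E d k =
      ∏ i ∈ Finset.range k, (1 - (1 - t) ^ (i + 1)) := by
  induction k with
  | zero =>
    rw [Finset.sum_range_succ']
    simp [rowSetSum_succ_zero, rowSetSum_zero_zero]
  | succ k ih =>
    have hdvd : t ∣ E - 1 := ⟨E, by linear_combination hE⟩
    have htop : rowSetSum E (n + 1) (k + 1) = 0 := by
      have := pow_dvd_rowSetSum hdvd (n + 1) (k + 1)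
      rwa [ht, zero_dvd_iff] at this
    have hrec : ∑ d ∈ Finset.range (n + 1), rowSetSum E d (k + 1) =
        (∑ d ∈ Finset.range (n + 1), rowSetSum E d k -
          ∑ d ∈ Finset.range (n + 1), rowSetSum E d (k + 1)) * (E ^ (k + 1) - 1) := by
      rw [← Finset.sum_sub_distrib, Finset.sum_mul]
      simp_rw [← rowSetSum_succ_succ]
      have := Finset.sum_range_succ' (fun d => rowSetSum E d (k + 1)) (n + 1)
      rw [Finset.sum_range_succ, htop, rowSetSum_eq_zero_of_lt E k.succ_pos] at this
      simpa using this
    have hpow : E ^ (k + 1) * (1 - t) ^ (k + 1) = 1 := by rw [← mul_pow, hE, one_pow]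
    rw [Finset.prod_range_succ, ← ih]
    linear_combination (1 - t) ^ (k + 1) * hrec +
      (∑ d ∈ Finset.range (n + 1), rowSetSum E d k -
        ∑ d ∈ Finset.range (n + 1), rowSetSum E d (k + 1)) * hpow

lemma sum_powerset_rowSetWeight {E t : R} {n : ℕ} (ht : t ^ (n + 1) = 0)
    (hE : E * (1 - t) = 1) :
    ∑ d ∈ Finset.range (n + 1), ∑ T ∈ (Finset.range d).powerset, rowSetWeight E d T =
      ∑ m ∈ Finset.range (n + 1), ∏ i ∈ Finset.range m, (1 - (1 - t) ^ (i + 1)) := by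
  simp_rw [← sum_rowSetSum_eq_prod ht hE]
  rw [Finset.sum_comm]
  refine Finset.sum_congr rfl fun d hd => ?_
  rw [Finset.sum_powerset, Finset.card_range]
  refine Finset.sum_subset (Finset.range_mono (by simpa using hd)) fun k _ hk => ?_
  exact rowSetSum_eq_zero_of_lt E (by simpa using hk)

end Weights

section GeneratingFunction

/-- The truncated geometric series `1 + X + ⋯ + X ^ n`. -/
noncomputable def truncGeom (n : ℕ) : ℤ[X] := ∑ x ∈ Finset.range (n + 1), X ^ x

lemma truncGeom_mul_one_sub (n : ℕ) : truncGeom n * (1 - X) = 1 - X ^ (n + 1) :=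
  geom_sum_mul_neg X (n + 1)

open Classical in
lemma sum_column_weight {ι : Type*} [Fintype ι] [DecidableEq ι] (n : ℕ) (S : Finset ι) :
    ∑ c ∈ Fintype.piFinset (fun _ : ι => Finset.range (n + 1)),
      (X : ℤ[X]) ^ (∑ i, c i) * (if c ≠ 0 ∧ ∀ i ∉ S, c i = 0 then 1 else 0) =
    truncGeom n ^ S.card - 1 := by
  have hsplit : ∀ c : ι → ℕ,
      (X : ℤ[X]) ^ (∑ i, c i) * (if c ≠ 0 ∧ ∀ i ∉ S, c i = 0 then 1 else 0) =
      (∏ i, X ^ c i * (if i ∉ S → c i = 0 then 1 else 0)) - if c = 0 then 1 else 0 := by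
    intro c
    rw [Finset.prod_mul_distrib, Finset.prod_pow_eq_pow_sum, Finset.prod_ite_zero]
    by_cases hc : c = 0
    · subst hc; simp
    · simp [hc]
  simp_rw [hsplit]
  rw [Finset.sum_sub_distrib, Finset.sum_prod_piFinset (Finset.range (n + 1))
    (fun i x => (X : ℤ[X]) ^ x * (if i ∉ S → x = 0 then 1 else 0))]
  congr 1
  · have : ∀ i, ∑ x ∈ Finset.range (n + 1), (X : ℤ[X]) ^ x * (if i ∉ S → x = 0 then 1 else 0) =
        if i ∈ S then truncGeom n else 1 := by
      intro i
      by_cases hi : i ∈ S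
      · simp [hi, truncGeom]
      · simp [hi]
    simp_rw [this]
    simp
  · rw [Finset.sum_ite_eq', if_pos (by simp)]

open Classical in
lemma sum_matrix_weight {d : ℕ} (n : ℕ) (T : Finset (Fin d)) :
    ∑ M ∈ Fintype.piFinset
        (fun _ : Fin d => Fintype.piFinset (fun _ : Fin d => Finset.range (n + 1))),
      (X : ℤ[X]) ^ (∑ j, ∑ i, M j i) *
        (if ∀ j, M j ≠ 0 ∧ ∀ i ∉ T.filter (· ≤ j), M j i = 0 then 1 else 0) =
    ∏ j, (truncGeom n ^ (T.filter (· ≤ j)).card - 1) := by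
  rw [Finset.prod_congr rfl fun j _ => (sum_column_weight n (T.filter (· ≤ j))).symm,
    Finset.prod_univ_sum]
  refine Finset.sum_congr rfl fun M _ => ?_
  rw [Finset.prod_mul_distrib, Finset.prod_pow_eq_pow_sum]
  congr 1
  by_cases h : ∀ j, M j ≠ 0 ∧ ∀ i ∉ T.filter (· ≤ j), M j i = 0
  · rw [if_pos h]
    exact (Finset.prod_eq_one fun j _ => if_pos (h j)).symm
  · obtain ⟨j, hj⟩ := not_forall.1 h
    rw [if_neg h]
    exact (Finset.prod_eq_zero (Finset.mem_univ j) (if_neg hj)).symm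

open Classical in
lemma ite_forall_exists_ne_zero {d : ℕ} (M : Fin d → Fin d → ℕ) :
    (if ∀ i, ∃ j, M j i ≠ 0 then (1 : ℤ[X]) else 0) =
      ∑ T : Finset (Fin d), (∏ j, if j ∈ T then (1 : ℤ[X]) else -1) *
        if ∀ i ∉ T, ∀ j, M j i = 0 then 1 else 0 := by
  have h : (if ∀ i, ∃ j, M j i ≠ 0 then (1 : ℤ[X]) else 0) =
      ∏ i, (1 + -(if ∀ j, M j i = 0 then (1 : ℤ[X]) else 0)) := by
    have : ∀ i, (1 + -(if ∀ j, M j i = 0 then (1 : ℤ[X]) else 0)) =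
        if ∃ j, M j i ≠ 0 then 1 else 0 := by
      intro i
      by_cases hi : ∀ j, M j i = 0
      · simp [hi]
      · rw [if_neg hi, if_pos (by simpa using hi)]; simp
    simp_rw [this]
    rw [Finset.prod_ite_zero]
    simp
  rw [h, Finset.prod_add, Finset.powerset_univ]
  refine Finset.sum_congr rfl fun T _ => ?_
  rw [Finset.prod_neg, Finset.prod_ite_zero, Finset.prod_ite]
  have : Finset.univ.filter (fun j => j ∉ T) = Finset.univ \ T := by ext; simp
  simp [this]

open Classical in
/-- The matrices of size `d`, listed by columns, that belong to `I_n`. -/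
noncomputable def columnMatrices (n d : ℕ) : Finset (Fin d → Fin d → ℕ) :=
  (Fintype.piFinset
    (fun _ : Fin d => Fintype.piFinset (fun _ : Fin d => Finset.range (n + 1)))).filter
    fun M => (∑ j, ∑ i, M j i = n) ∧ (∀ j i, j < i → M j i = 0) ∧ (∀ j, M j ≠ 0) ∧
      ∀ i, ∃ j, M j i ≠ 0

lemma mem_columnMatrices {n d : ℕ} {M : Fin d → Fin d → ℕ} :
    M ∈ columnMatrices n d ↔ (∀ j i, M j i ≤ n) ∧ (∑ j, ∑ i, M j i = n) ∧
      (∀ j i, j < i → M j i = 0) ∧ (∀ j, M j ≠ 0) ∧ ∀ i, ∃ j, M j i ≠ 0 := by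
  simp [columnMatrices]

lemma sum_powerset_range_eq_sum_fin {R : Type*} [CommRing R] (E : R) (d : ℕ) :
    ∑ T ∈ (Finset.range d).powerset, rowSetWeight E d T =
      ∑ T : Finset (Fin d), (∏ j, if j ∈ T then (1 : R) else -1) *
        ∏ j, (E ^ (T.filter (· ≤ j)).card - 1) := by
  symm
  refine Finset.sum_bij (fun T _ => T.map Fin.valEmbedding) ?_ ?_ ?_ ?_
  · intro T _
    rw [Finset.mem_powerset]
    intro x hx
    obtain ⟨y, -, rfl⟩ := Finset.mem_map.1 hx
    simp
  · intro S _ T _ h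
    exact Finset.map_injective _ h
  · intro T hT
    refine ⟨Finset.univ.filter (fun i : Fin d => (i : ℕ) ∈ T), Finset.mem_univ _, ?_⟩
    ext x
    simp only [Finset.mem_map, Finset.mem_filter, Finset.mem_univ, true_and,
      Fin.valEmbedding_apply]
    constructor
    · rintro ⟨y, hy, rfl⟩
      exact hy
    · intro hx
      exact ⟨⟨x, by simpa using Finset.mem_powerset.1 hT hx⟩, hx, rfl⟩
  · intro T _
    rw [rowSetWeight, Finset.prod_range, ← Finset.prod_mul_distrib]
    refine Finset.prod_congr rfl fun j _ => ?_
    rw [Finset.filter_map, Finset.card_map]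
    simp [Fin.val_inj]

lemma card_columnMatrices (n d : ℕ) :
    ((columnMatrices n d).card : ℤ) =
      (∑ T ∈ (Finset.range d).powerset, rowSetWeight (truncGeom n) d T).coeff n := by
  classical
  have hind : ∀ M : Fin d → Fin d → ℕ,
      (if (∀ j i, j < i → M j i = 0) ∧ (∀ j, M j ≠ 0) ∧ ∀ i, ∃ j, M j i ≠ 0
        then (1 : ℤ[X]) else 0) =
      ∑ T : Finset (Fin d), (∏ j, if j ∈ T then (1 : ℤ[X]) else -1) *
        if ∀ j, M j ≠ 0 ∧ ∀ i ∉ T.filter (· ≤ j), M j i = 0 then 1 else 0 := by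
    intro M
    by_cases h : (∀ j i, j < i → M j i = 0) ∧ (∀ j, M j ≠ 0)
    · have h' := ite_forall_exists_ne_zero M
      simp only [h, implies_true, true_and, ne_eq, not_false_eq_true] at h' ⊢
      rw [if_congr (by rw [and_iff_right h.1]) rfl rfl, h']
      refine Finset.sum_congr rfl fun T _ => ?_
      congr 1
      refine if_congr ⟨fun H j i hi => ?_, fun H i hi j => ?_⟩ rfl rfl
      · by_cases hT : i ∈ T
        · exact h.1 j i (by simpa [hT] using hi)
        · exact H i hT j
      · exact H j i (by simp [hi])
    · rw [if_neg fun H => h ⟨H.1, H.2.1⟩]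
      refine (Finset.sum_eq_zero fun T _ => ?_).symm
      rw [if_neg, mul_zero]
      intro H
      exact h ⟨fun j i hji => (H j).2 i (by simp [hji]), fun j => (H j).1⟩
  have hsum : ∀ M : Fin d → Fin d → ℕ,
      (X : ℤ[X]) ^ (∑ j, ∑ i, M j i) *
        (if (∀ j i, j < i → M j i = 0) ∧ (∀ j, M j ≠ 0) ∧ ∀ i, ∃ j, M j i ≠ 0
          then (1 : ℤ[X]) else 0) =
      ∑ T : Finset (Fin d), (∏ j, if j ∈ T then (1 : ℤ[X]) else -1) *
        (X ^ (∑ j, ∑ i, M j i) *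
          if ∀ j, M j ≠ 0 ∧ ∀ i ∉ T.filter (· ≤ j), M j i = 0 then 1 else 0) := by
    intro M
    rw [hind, Finset.mul_sum]
    exact Finset.sum_congr rfl fun T _ => mul_left_comm _ _ _
  rw [sum_powerset_range_eq_sum_fin]
  rw [Finset.sum_congr rfl fun T _ =>
    (congrArg (_ * ·) (sum_matrix_weight n T).symm).trans (Finset.mul_sum _ _ _),
    Finset.sum_comm, Finset.sum_congr rfl fun M _ => (hsum M).symm,
    Polynomial.finsetSum_coeff, columnMatrices, Finset.card_filter, Nat.cast_sum]
  refine Finset.sum_congr rfl fun M _ => ?_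
  by_cases h : (∀ j i, j < i → M j i = 0) ∧ (∀ j, M j ≠ 0) ∧ ∀ i, ∃ j, M j i ≠ 0
  · rw [if_pos h, mul_one, coeff_X_pow, Nat.cast_ite, Nat.cast_one, Nat.cast_zero]
    exact if_congr ⟨fun H => H.1.symm, fun H => ⟨H.symm, h⟩⟩ rfl rfl
  · rw [if_neg h, mul_zero, coeff_zero, if_neg fun H => h H.2, Nat.cast_zero]

end GeneratingFunction

lemma map_sum_powerset_rowSetWeight {R : Type*} [CommRing R] {n : ℕ} (φ : ℤ[X] →+* R)
    (hX : φ (X ^ (n + 1)) = 0) :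
    φ (∑ d ∈ Finset.range (n + 1), ∑ T ∈ (Finset.range d).powerset,
        rowSetWeight (truncGeom n) d T) =
      φ (∑ m ∈ Finset.range (n + 1), ∏ i ∈ Finset.range m, (1 - (1 - X) ^ (i + 1))) := by
  have hE : φ (truncGeom n) * (1 - φ X) = 1 := by
    have := congrArg φ (truncGeom_mul_one_sub n)
    simpa only [map_mul, map_sub, map_one, hX, sub_zero] using this
  have key := sum_powerset_rowSetWeight (t := φ X) (by rwa [map_pow] at hX) hE
  simpa [rowSetWeight, apply_ite φ] using key

lemma sum_card_columnMatrices (n : ℕ) :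
    ∑ d ∈ Finset.range (n + 1), ((columnMatrices n d).card : ℤ) =
      (∑ m ∈ Finset.range (n + 1), ∏ i ∈ Finset.range m,
        ((1 : ℤ[X]) - (1 - X) ^ (i + 1))).coeff n := by
  simp_rw [card_columnMatrices]
  rw [← Polynomial.finsetSum_coeff]
  have hφ := map_sum_powerset_rowSetWeight (Ideal.Quotient.mk (Ideal.span {X ^ (n + 1)}))
    (Ideal.Quotient.eq_zero_iff_mem.2 (Ideal.mem_span_singleton_self _))
  rw [Ideal.Quotient.mk_eq_mk_iff_sub_mem, Ideal.mem_span_singleton,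
    Polynomial.X_pow_dvd_iff] at hφ
  simpa [sub_eq_zero] using hφ n n.lt_succ_self

namespace SqMat

lemma ent_of_fin (A : SqMat) (i j : Fin A.1) : A.ent i j = A.2 i j := by
  simp [ent]

lemma rsum_eq_sum (A : SqMat) (i : Fin A.1) : A.rsum i = ∑ j, A.2 i j := by
  simp_rw [rsum, Finset.sum_range, ent_of_fin]

lemma csum_eq_sum (A : SqMat) (j : Fin A.1) : A.csum j = ∑ i, A.2 i j := by
  simp_rw [csum, Finset.sum_range, ent_of_fin]

lemma total_eq_sum (A : SqMat) : A.total = ∑ j, ∑ i, A.2 i j := by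
  simp_rw [total, Finset.sum_range, rsum_eq_sum]
  exact Finset.sum_comm

lemma memI_iff (n : ℕ) (A : SqMat) :
    MemI n A ↔ A.1 ∈ Finset.range (n + 1) ∧ A.2.transpose ∈ columnMatrices n A.1 := by
  have hut : A.UpperTri ↔ ∀ j i, j < i → A.2 i j = 0 := by
    constructor
    · intro h j i hji
      rw [← ent_of_fin]
      exact h i j hji
    · intro h r c hcr
      by_cases H : r < A.1 ∧ c < A.1
      · rw [ent, dif_pos H]
        exact h ⟨c, H.2⟩ ⟨r, H.1⟩ hcr
      · rw [ent, dif_neg H]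
  have hrows : A.RowsNonzero ↔ ∀ i, ∃ j, A.2 i j ≠ 0 := by
    rw [RowsNonzero, ← Fin.forall_iff (p := fun i : Fin A.1 => 0 < A.rsum i)]
    simp_rw [rsum_eq_sum, Finset.sum_pos_iff, Nat.pos_iff_ne_zero]
    simp
  have hcols : A.ColsNonzero ↔ ∀ j, A.2.transpose j ≠ 0 := by
    rw [ColsNonzero, ← Fin.forall_iff (p := fun i : Fin A.1 => 0 < A.csum i)]
    simp_rw [csum_eq_sum, Finset.sum_pos_iff, Nat.pos_iff_ne_zero, Function.ne_iff]
    simp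
  rw [MemI, hut, hrows, hcols, total_eq_sum]
  constructor
  · rintro ⟨h1, h2, h3, h4⟩
    refine ⟨?_, mem_columnMatrices.2 ⟨fun j i => ?_, h2, h1, h4, h3⟩⟩
    · rw [Finset.mem_range, Nat.lt_succ_iff, ← h2, Finset.sum_comm]
      calc A.1 = ∑ _i : Fin A.1, 1 := by simp
        _ ≤ _ := Finset.sum_le_sum fun i _ => by
          obtain ⟨j, hj⟩ := h3 i
          exact (Nat.one_le_iff_ne_zero.2 hj).trans
            (Finset.single_le_sum (f := fun j => A.2 i j) (fun _ _ => Nat.zero_le _)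
              (Finset.mem_univ j))
    · rw [← h2]
      exact (Finset.single_le_sum (f := fun i => A.2 i j) (fun _ _ => Nat.zero_le _)
          (Finset.mem_univ i)).trans
        (Finset.single_le_sum (f := fun j => ∑ i, A.2 i j) (fun _ _ => Nat.zero_le _)
          (Finset.mem_univ j))
  · rintro ⟨-, h⟩
    obtain ⟨-, h2, h1, h4, h3⟩ := mem_columnMatrices.1 h
    exact ⟨h1, h2, h3, h4⟩

lemma ncard_memI (n : ℕ) :
    {A : SqMat | MemI n A}.ncard = ∑ d ∈ Finset.range (n + 1), (columnMatrices n d).card := by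
  rw [← Finset.card_sigma, ← Set.ncard_coe_finset]
  refine Set.ncard_congr (fun A _ => ⟨A.1, A.2.transpose⟩) ?_ ?_ ?_
  · intro A hA
    exact Finset.mem_coe.2 (Finset.mem_sigma.2 ((memI_iff n A).1 hA))
  · rintro ⟨d, A⟩ ⟨e, B⟩ _ _ h
    obtain ⟨rfl, h⟩ := Sigma.mk.inj_iff.1 h
    exact congrArg (Sigma.mk d) (Matrix.transpose_injective (eq_of_heq h))
  · rintro ⟨d, M⟩ hM
    refine ⟨⟨d, Matrix.transpose M⟩, (memI_iff n _).2 ?_, rfl⟩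
    exact Finset.mem_sigma.1 (Finset.mem_coe.1 hM)

end SqMat

/-- For every positive integer `n`, the number of matrices in `I_n`
equals the coefficient of `t^n` in the polynomial `Σ_{m=0}^{n} ∏_{i=1}^{m} (1 - (1-t)^i)`
(with integer coefficients); the product index `i ∈ Finset.range m` corresponds to the
paper's `i+1`, so `(1-t)^i` becomes `(1 - X)^(i+1)`. -/
theorem card_intMat_eq_coeff (n : ℕ) (hn : 0 < n) :
    ({A : SqMat | SqMat.MemI n A}.ncard : ℤ)
    = (∑ m ∈ Finset.range (n + 1), ∏ i ∈ Finset.range m,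
        ((1 : Polynomial ℤ) - (1 - X) ^ (i + 1))).coeff n := by
  rw [SqMat.ncard_memI, Nat.cast_sum, sum_card_columnMatrices]
end
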